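/- arXiv:2101.02193 — 3 statements merged into one kernel-verified Lean document; each statement's English description precedes it below -/
import Mathlib

section
/- Let R be a nontrivial cyclically reduced element of the commutator subgroup F(a,b)' of F(a,b). Then the following are equivalent: (i) there exists a line segment K ⊆ ℝ² containing more than one point such that the convex hull of the trace of R equals the Minkowski sum K + [0,1]×[0,1]; (ii) there exists T in the Aut(F(a,b))-orbit of R which has shortest length in that orbit, lies in ⟨a, b⁻¹ab⟩, and is not conjugate in F(a,b) to [a,b]^k for any integer k. (This is the equivalence of conditions (2) and (3) of the main theorem: the Friedl–Tillmann polytope of ⟨a,b | R⟩ is a straight line but not a single point if and only if condition (ii) holds.) -/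
open Pointwise

/-- The free group `F(a,b)` on two generators. -/
abbrev F : Type := FreeGroup (Fin 2)

/-- The generator `a` of `F(a,b)`. -/
def a : F := FreeGroup.of 0

/-- The generator `b` of `F(a,b)`. -/
def b : F := FreeGroup.of 1

/-- The subgroup `⟨a, b⁻¹ab⟩` of `F(a,b)`. -/
def H : Subgroup F := Subgroup.closure {a, b⁻¹ * a * b}

/-- The commutator `[a,b] = aba⁻¹b⁻¹`. -/
def commAB : F := a * b * a⁻¹ * b⁻¹

/-- The exponent sum of `a` in a word over `{a, a⁻¹, b, b⁻¹}`. -/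
def aSum (w : List (Fin 2 × Bool)) : ℤ :=
  (w.map fun l => if l.1 = 0 then (if l.2 then (1 : ℤ) else -1) else 0).sum

/-- The exponent sum of `b` in a word over `{a, a⁻¹, b, b⁻¹}`. -/
def bSum (w : List (Fin 2 × Bool)) : ℤ :=
  (w.map fun l => if l.1 = 1 then (if l.2 then (1 : ℤ) else -1) else 0).sum

/-- `W` is cyclically reduced: its reduced word has minimal length among conjugates. -/
def IsCyclicallyReduced (W : F) : Prop :=
  ∀ g : F, FreeGroup.norm W ≤ FreeGroup.norm (g * W * g⁻¹)

/-- The trace of `W`: the images in `ℝ²` of all prefixes of the reduced word of `W`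
under `a ↦ (1,0)`, `b ↦ (0,1)`. -/
def trace (W : F) : Set (ℝ × ℝ) :=
  {p | ∃ u : List (Fin 2 × Bool), u <+: W.toWord ∧ p = ((aSum u : ℝ), (bSum u : ℝ))}

/-- The unit square `[0,1] × [0,1] ⊆ ℝ²`. -/
def unitSquare : Set (ℝ × ℝ) := Set.Icc (0 : ℝ) 1 ×ˢ Set.Icc (0 : ℝ) 1

namespace FreeGroupRankTwo

/-! ### Common prefixes and cancellation -/

/-- The length of the longest common prefix of two words. -/
def commonPrefixLength : List (Fin 2 × Bool) → List (Fin 2 × Bool) → ℕ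
  | [], _ => 0
  | _ :: _, [] => 0
  | x :: s, y :: t => if x = y then commonPrefixLength s t + 1 else 0

theorem commonPrefixLength_comm (s t : List (Fin 2 × Bool)) :
    commonPrefixLength s t = commonPrefixLength t s := by
  induction s generalizing t with
  | nil => cases t <;> simp [commonPrefixLength]
  | cons x s ih =>
    cases t with
    | nil => simp [commonPrefixLength]
    | cons y t => simp [commonPrefixLength, ih t, eq_comm]

theorem min_commonPrefixLength_le (s r t : List (Fin 2 × Bool)) :
    min (commonPrefixLength s r) (commonPrefixLength r t) ≤ commonPrefixLength s t := by
  induction s generalizing r t with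
  | nil => simp [commonPrefixLength]
  | cons x s ih =>
    cases r with
    | nil => simp [commonPrefixLength]
    | cons y r =>
      cases t with
      | nil => simp [commonPrefixLength]
      | cons z t =>
        have := ih r t
        simp only [commonPrefixLength]
        split_ifs <;> simp_all

theorem exists_eq_append_commonPrefix (s t : List (Fin 2 × Bool)) :
    ∃ p s' t', s = p ++ s' ∧ t = p ++ t' ∧ p.length = commonPrefixLength s t ∧
      ∀ x ∈ s'.head?, ∀ y ∈ t'.head?, x ≠ y := by
  induction s generalizing t with
  | nil => exact ⟨[], [], t, by simp [commonPrefixLength]⟩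
  | cons x s ih =>
    cases t with
    | nil => exact ⟨[], x :: s, [], by simp [commonPrefixLength]⟩
    | cons y t =>
      by_cases h : x = y
      · obtain ⟨p, s', t', h1, h2, h3, h4⟩ := ih t
        exact ⟨x :: p, s', t', by simp [h1], by simp [h2, h], by
          simp [commonPrefixLength, h, h3], h4⟩
      · exact ⟨[], x :: s, y :: t, by simp, by simp, by simp [commonPrefixLength, h],
          by simpa using h⟩

/-- The Gromov product of two elements of `F` based at the identity. -/
def gromov (g h : F) : ℕ := commonPrefixLength g.toWord h.toWord

theorem gromov_comm (g h : F) : gromov g h = gromov h g := commonPrefixLength_comm _ _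

theorem min_gromov_le (g h k : F) : min (gromov g h) (gromov h k) ≤ gromov g k :=
  min_commonPrefixLength_le _ _ _

theorem norm_mk_of_isReduced {w : List (Fin 2 × Bool)} (h : FreeGroup.IsReduced w) :
    FreeGroup.norm (FreeGroup.mk w) = w.length := by
  rw [FreeGroup.norm, FreeGroup.toWord_mk, h.reduce_eq]

theorem norm_inv_mul_add (g h : F) :
    FreeGroup.norm (g⁻¹ * h) + 2 * gromov g h = FreeGroup.norm g + FreeGroup.norm h := by
  obtain ⟨p, s, t, h1, h2, h3, h4⟩ := exists_eq_append_commonPrefix g.toWord h.toWord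
  have hg : g = FreeGroup.mk (p ++ s) := by rw [← h1, FreeGroup.mk_toWord]
  have hh : h = FreeGroup.mk (p ++ t) := by rw [← h2, FreeGroup.mk_toWord]
  have hgr : FreeGroup.IsReduced (p ++ s) := h1 ▸ FreeGroup.isReduced_toWord
  have hhr : FreeGroup.IsReduced (p ++ t) := h2 ▸ FreeGroup.isReduced_toWord
  have e : g⁻¹ * h = FreeGroup.mk (FreeGroup.invRev s ++ t) := by
    rw [hg, hh, ← FreeGroup.mul_mk, ← FreeGroup.mul_mk, ← FreeGroup.mul_mk, ← FreeGroup.inv_mk]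
    group
  have hs : FreeGroup.IsReduced (FreeGroup.invRev s) := by
    rw [FreeGroup.isReduced_iff_reduce_eq, FreeGroup.reduce_invRev,
      FreeGroup.IsReduced.reduce_eq (List.isChain_append.1 hgr).2.1]
  have hr : FreeGroup.IsReduced (FreeGroup.invRev s ++ t) := by
    refine List.isChain_append.2 ⟨hs, (List.isChain_append.1 hhr).2.1, ?_⟩
    intro x hx y hy hxy
    have hx' : ∃ z ∈ s.head?, x = (z.1, !z.2) := by
      cases s with
      | nil => simp at hx
      | cons z s => exact ⟨z, by simp, by simpa [FreeGroup.invRev, eq_comm] using hx⟩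
    obtain ⟨z, hz, rfl⟩ := hx'
    have := h4 z hz y hy
    by_contra hne
    exact this (Prod.ext hxy (by simpa using hne))
  have hgp : gromov g h = p.length := h3.symm
  rw [e, hgp, norm_mk_of_isReduced hr, hg, hh, norm_mk_of_isReduced hgr, norm_mk_of_isReduced hhr]
  simp
  ring

theorem norm_mul_add (g h : F) :
    FreeGroup.norm (g * h) + 2 * gromov g⁻¹ h = FreeGroup.norm g + FreeGroup.norm h := by
  have := norm_inv_mul_add g⁻¹ h
  rwa [inv_inv, FreeGroup.norm_inv_eq] at this

theorem two_mul_gromov_inv_self_lt {g : F} (hg : g ≠ 1) :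
    2 * gromov g⁻¹ g < FreeGroup.norm g := by
  have h := norm_mul_add g g
  have h1 := FreeGroup.reduceCyclically.reduce_flatten_replicate_succ
    (FreeGroup.isReduced_toWord (x := g)) 1
  have h2 := FreeGroup.reduceCyclically.conj_conjugator_reduceCyclically g.toWord
  set c := FreeGroup.reduceCyclically.conjugator g.toWord
  set r := FreeGroup.reduceCyclically g.toWord
  have hr : r ≠ [] := by
    intro hr
    apply hg
    rw [← FreeGroup.mk_toWord (x := g), ← h2, hr, List.append_nil, ← FreeGroup.mul_mk,
      ← FreeGroup.inv_mk, mul_inv_cancel]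
  have hr' : 0 < r.length := List.length_pos_iff.2 hr
  have h3 : FreeGroup.norm (g * g) = 2 * c.length + 2 * r.length := by
    rw [FreeGroup.norm, FreeGroup.toWord_mul]
    have : g.toWord ++ g.toWord = (List.replicate (1 + 1) g.toWord).flatten := by
      simp [List.replicate]
    rw [this, h1]
    simp
    ring
  have h4 : FreeGroup.norm g = 2 * c.length + r.length := by
    rw [FreeGroup.norm, ← h2]
    simp
    ring
  omega

theorem gromov_eq_of_lt {g h k : F} (hlt : gromov h g < gromov g k) :
    gromov h k = gromov h g := by
  have h1 := min_gromov_le h g k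
  have h2 := min_gromov_le h k g
  rw [gromov_comm k g] at h2
  omega

/-! ### Elementary Nielsen automorphisms -/

theorem hom_ext {G : Type*} [Group G] {f g : F →* G} (ha : f a = g a) (hb : f b = g b) : f = g := by
  ext i
  fin_cases i
  · exact ha
  · exact hb

/-- The endomorphism of `F` with `a ↦ u` and `b ↦ v`. -/
def endo (u v : F) : F →* F := FreeGroup.lift ![u, v]

@[simp] theorem endo_a (u v : F) : endo u v a = u := by simp [endo, a]

@[simp] theorem endo_b (u v : F) : endo u v b = v := by simp [endo, b]

/-- The automorphism `a ↦ a⁻¹`, `b ↦ b`. -/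
def flipA : MulAut F :=
  (endo a⁻¹ b).toMulEquiv (endo a⁻¹ b) (hom_ext (by simp) (by simp)) (hom_ext (by simp) (by simp))

/-- The automorphism `a ↦ b`, `b ↦ a`. -/
def swapAB : MulAut F :=
  (endo b a).toMulEquiv (endo b a) (hom_ext (by simp) (by simp)) (hom_ext (by simp) (by simp))

/-- The automorphism `a ↦ ab`, `b ↦ b`. -/
def transv : MulAut F :=
  (endo (a * b) b).toMulEquiv (endo (a * b⁻¹) b) (hom_ext (by simp) (by simp))
    (hom_ext (by simp) (by simp))

@[simp] theorem flipA_a : flipA a = a⁻¹ := endo_a a⁻¹ b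
@[simp] theorem flipA_b : flipA b = b := endo_b a⁻¹ b
@[simp] theorem swapAB_a : swapAB a = b := endo_a b a
@[simp] theorem swapAB_b : swapAB b = a := endo_b b a
@[simp] theorem transv_a : transv a = a * b := endo_a (a * b) b
@[simp] theorem transv_b : transv b = b := endo_b (a * b) b

/-- The group generated by the elementary Nielsen and the inner automorphisms. -/
def nielsen : Subgroup (MulAut F) :=
  Subgroup.closure ({flipA, swapAB, transv} ∪ Set.range MulAut.conj)

theorem flipA_mem : flipA ∈ nielsen := Subgroup.subset_closure (by simp)
theorem swapAB_mem : swapAB ∈ nielsen := Subgroup.subset_closure (by simp)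
theorem transv_mem : transv ∈ nielsen := Subgroup.subset_closure (by simp)
theorem conj_mem (g : F) : MulAut.conj g ∈ nielsen := Subgroup.subset_closure (by simp)

theorem mulAut_ext {α β : MulAut F} (ha : α a = β a) (hb : α b = β b) : α = β := by
  have : α.toMonoidHom = β.toMonoidHom := hom_ext ha hb
  ext x
  exact DFunLike.congr_fun this x

/-- The element of `F` given by a letter. -/
def letter (x : Fin 2 × Bool) : F := FreeGroup.mk [x]

/-- The inverse letter. -/
def inv' (x : Fin 2 × Bool) : Fin 2 × Bool := (x.1, !x.2)

theorem letter_inv' (x : Fin 2 × Bool) : letter (inv' x) = (letter x)⁻¹ := by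
  simp [letter, inv', FreeGroup.inv_mk, FreeGroup.invRev]

theorem a_eq : a = letter (0, true) := rfl
theorem b_eq : b = letter (1, true) := rfl
theorem a_inv_eq : a⁻¹ = letter (0, false) := rfl
theorem b_inv_eq : b⁻¹ = letter (1, false) := rfl

theorem exists_nielsen_letters {x y : Fin 2 × Bool} (h : x.1 ≠ y.1) :
    ∃ σ ∈ nielsen, σ a = letter x ∧ σ b = letter y := by
  have key : ∀ ε δ : Bool, ∃ σ ∈ nielsen, σ a = letter (0, ε) ∧ σ b = letter (1, δ) := by
    have hf : swapAB * flipA * swapAB ∈ nielsen :=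
      nielsen.mul_mem (nielsen.mul_mem swapAB_mem flipA_mem) swapAB_mem
    rintro (_ | _) (_ | _)
    · exact ⟨_, nielsen.mul_mem flipA_mem hf, by simp [← a_inv_eq], by simp [← b_inv_eq]⟩
    · exact ⟨_, flipA_mem, by simp [← a_inv_eq], by simp [← b_eq]⟩
    · exact ⟨_, hf, by simp [← a_eq], by simp [← b_inv_eq]⟩
    · exact ⟨1, nielsen.one_mem, by simp [← a_eq], by simp [← b_eq]⟩
  obtain ⟨i, ε⟩ := x
  obtain ⟨j, δ⟩ := y
  fin_cases i <;> fin_cases j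
  · exact absurd rfl h
  · exact key ε δ
  · obtain ⟨σ, hσ, h1, h2⟩ := key δ ε
    exact ⟨σ * swapAB, nielsen.mul_mem hσ swapAB_mem, by simpa using h2, by simpa using h1⟩
  · exact absurd rfl h

theorem letter_ne_one (x : Fin 2 × Bool) : letter x ≠ 1 := by
  intro h
  have : FreeGroup.norm (letter x) = 1 := norm_mk_of_isReduced FreeGroup.IsReduced.singleton
  rw [h] at this
  simp at this

/-! ### Generation of the automorphism group -/

theorem letter_eq_of_fst_eq {x y : Fin 2 × Bool} (h : x.1 = y.1) : x = y ∨ x = inv' y := by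
  obtain ⟨i, ε⟩ := x
  obtain ⟨j, δ⟩ := y
  obtain rfl : i = j := h
  cases ε <;> cases δ <;> simp [inv']

/-- The total length of the images of the two generators. -/
def basisLength (α : MulAut F) : ℕ := FreeGroup.norm (α a) + FreeGroup.norm (α b)

/-- No automorphism in the subgroup `nielsen` shortens the images of the two generators. -/
def NielsenMinimal (α : MulAut F) : Prop :=
  ∀ γ ∈ nielsen, basisLength α ≤ basisLength (α * γ)

section Minimal

variable {α : MulAut F}

theorem norm_apply_letter (α : MulAut F) (x : Fin 2 × Bool) :
    FreeGroup.norm (α (letter x)) = FreeGroup.norm (α (letter (x.1, true))) := by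
  obtain ⟨i, ε⟩ := x
  cases ε
  · have : letter (i, false) = (letter (i, true))⁻¹ := letter_inv' (i, true)
    rw [this, map_inv, FreeGroup.norm_inv_eq]
  · rfl

theorem basisLength_eq (α : MulAut F) {x y : Fin 2 × Bool} (h : x.1 ≠ y.1) :
    basisLength α = FreeGroup.norm (α (letter x)) + FreeGroup.norm (α (letter y)) := by
  rw [norm_apply_letter α x, norm_apply_letter α y, basisLength, a_eq, b_eq]
  obtain ⟨i, ε⟩ := x
  obtain ⟨j, δ⟩ := y
  fin_cases i <;> fin_cases j <;> simp_all [add_comm]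

theorem apply_letter_ne_one (x : Fin 2 × Bool) : α (letter x) ≠ 1 := by
  rw [Ne, EmbeddingLike.map_eq_one_iff]
  exact letter_ne_one x

theorem norm_add_norm_le_conj (hmin : NielsenMinimal α) {x y : Fin 2 × Bool} (h : x.1 ≠ y.1)
    (g : F) :
    FreeGroup.norm (α (letter x)) + FreeGroup.norm (α (letter y)) ≤
      FreeGroup.norm (g * (α (letter x) * α (letter y)) * g⁻¹) +
        FreeGroup.norm (g * α (letter y) * g⁻¹) := by
  obtain ⟨σ, hσ, h1, h2⟩ := exists_nielsen_letters h
  have := hmin (MulAut.conj (α⁻¹ g) * (σ * transv))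
    (nielsen.mul_mem (conj_mem _) (nielsen.mul_mem hσ transv_mem))
  rw [basisLength_eq α h] at this
  simpa [basisLength, h1, h2] using this

theorem norm_le_norm_mul (hmin : NielsenMinimal α) {x y : Fin 2 × Bool} (h : x.1 ≠ y.1) :
    FreeGroup.norm (α (letter x)) ≤ FreeGroup.norm (α (letter x) * α (letter y)) := by
  have := norm_add_norm_le_conj hmin h 1
  simpa using this

theorem norm_le_norm_mul' (hmin : NielsenMinimal α) {x y : Fin 2 × Bool} (h : x.1 ≠ y.1) :
    FreeGroup.norm (α (letter y)) ≤ FreeGroup.norm (α (letter x) * α (letter y)) := by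
  have := norm_le_norm_mul hmin (x := inv' y) (y := inv' x) h.symm
  rwa [letter_inv', letter_inv', map_inv, map_inv, ← mul_inv_rev, FreeGroup.norm_inv_eq,
    FreeGroup.norm_inv_eq] at this

theorem two_mul_gromov_le (hmin : NielsenMinimal α) {x y : Fin 2 × Bool} (h : x.1 ≠ y.1) :
    2 * gromov (α (letter x))⁻¹ (α (letter y)) ≤ FreeGroup.norm (α (letter y)) ∧
      2 * gromov (α (letter x))⁻¹ (α (letter y)) ≤ FreeGroup.norm (α (letter x)) := by
  have h1 := norm_le_norm_mul hmin h
  have h2 := norm_le_norm_mul' hmin h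
  have h3 := norm_mul_add (α (letter x)) (α (letter y))
  omega

theorem gromov_add_gromov_same_lt (hmin : NielsenMinimal α) {x y : Fin 2 × Bool} (h : x.1 ≠ y.1) :
    gromov (α (letter x))⁻¹ (α (letter y)) + gromov (α (letter y))⁻¹ (α (letter x)) <
      FreeGroup.norm (α (letter y)) := by
  by_contra hcon
  have h1 := two_mul_gromov_le hmin h
  have h2 := two_mul_gromov_le hmin h.symm
  have hy : FreeGroup.norm (α (letter y)) ≠ 0 := by
    rw [Ne, FreeGroup.norm_eq_zero]
    exact apply_letter_ne_one y
  have h5 := norm_add_norm_le_conj hmin h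
  set X := α (letter x)
  set Y := α (letter y)
  obtain ⟨P, s, Q, e1, e2, e3, -⟩ := exists_eq_append_commonPrefix X⁻¹.toWord Y.toWord
  obtain ⟨Q', t, s', f1, f2, f3, -⟩ := exists_eq_append_commonPrefix Y⁻¹.toWord X.toWord
  change P.length = gromov X⁻¹ Y at e3
  change Q'.length = gromov Y⁻¹ X at f3
  have hYl : FreeGroup.norm Y = P.length + Q.length := by rw [FreeGroup.norm, e2]; simp
  have hXl : FreeGroup.norm X = Q'.length + s'.length := by rw [FreeGroup.norm, f2]; simp
  have hQ : Q' = FreeGroup.invRev Q := by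
    rw [FreeGroup.toWord_inv, e2, FreeGroup.invRev_append] at f1
    refine (List.append_inj_left f1 ?_).symm
    rw [FreeGroup.invRev_length]
    omega
  have hX : X.toWord = FreeGroup.invRev s ++ FreeGroup.invRev P := by
    rw [← FreeGroup.invRev_append, ← e1, FreeGroup.toWord_inv, FreeGroup.invRev_invRev]
  have hpre : FreeGroup.invRev Q <+: FreeGroup.invRev s := by
    refine List.prefix_of_prefix_length_le (l₃ := X.toWord) ?_ ?_ ?_
    · rw [f2, hQ]
      exact List.prefix_append _ _
    · rw [hX]
      exact List.prefix_append _ _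
    · have := congrArg List.length hX
      rw [f2, hQ] at this
      simp only [List.length_append, FreeGroup.invRev_length] at this ⊢
      rw [hQ, FreeGroup.invRev_length] at hXl f3
      omega
  obtain ⟨m, hm⟩ := hpre
  have hYe : Y = FreeGroup.mk P * FreeGroup.mk Q := by
    rw [FreeGroup.mul_mk, ← e2, FreeGroup.mk_toWord]
  have hXe : X = (FreeGroup.mk Q)⁻¹ * FreeGroup.mk m * (FreeGroup.mk P)⁻¹ := by
    rw [FreeGroup.inv_mk, FreeGroup.inv_mk, FreeGroup.mul_mk, hm, FreeGroup.mul_mk, ← hX,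
      FreeGroup.mk_toWord]
  have hml : FreeGroup.norm X = Q.length + m.length + P.length := by
    rw [FreeGroup.norm, hX, ← hm]
    simp [add_assoc]
  have h6 := h5 (FreeGroup.mk Q)
  have e6 : FreeGroup.mk Q * (X * Y) * (FreeGroup.mk Q)⁻¹ = FreeGroup.mk m := by
    rw [hXe, hYe]
    group
  have e7 : FreeGroup.mk Q * Y * (FreeGroup.mk Q)⁻¹ = FreeGroup.mk (Q ++ P) := by
    rw [hYe, ← FreeGroup.mul_mk]
    group
  rw [e6, e7] at h6
  have h7 := FreeGroup.norm_mk_le (L₁ := m)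
  have h8 := FreeGroup.norm_mk_le (L₁ := Q ++ P)
  rw [List.length_append] at h8
  rw [hQ, FreeGroup.invRev_length] at f3
  omega

theorem gromov_add_gromov_lt (hmin : NielsenMinimal α) {x y z : Fin 2 × Bool} (hxy : x ≠ inv' y)
    (hyz : y ≠ inv' z) :
    gromov (α (letter x))⁻¹ (α (letter y)) + gromov (α (letter y))⁻¹ (α (letter z)) <
      FreeGroup.norm (α (letter y)) := by
  have h0 := two_mul_gromov_inv_self_lt (apply_letter_ne_one (α := α) y)
  by_cases h1 : x.1 = y.1
  · obtain rfl : x = y := (letter_eq_of_fst_eq h1).resolve_right hxy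
    by_cases h2 : x.1 = z.1
    · obtain rfl : x = z := (letter_eq_of_fst_eq h2).resolve_right hyz
      omega
    · have := two_mul_gromov_le hmin h2
      omega
  · have h3 := two_mul_gromov_le hmin h1
    by_cases h2 : y.1 = z.1
    · obtain rfl : y = z := (letter_eq_of_fst_eq h2).resolve_right hyz
      omega
    · have h4 := two_mul_gromov_le hmin h2
      have h5 : z.1 = x.1 := by
        obtain ⟨i, _⟩ := x
        obtain ⟨j, _⟩ := y
        obtain ⟨k, _⟩ := z
        simp only at h1 h2 ⊢
        omega
      rcases letter_eq_of_fst_eq h5 with rfl | rfl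
      · exact gromov_add_gromov_same_lt hmin h1
      · rw [letter_inv', map_inv] at h4 ⊢
        by_contra hcon
        have h6 := min_gromov_le (α (letter y))⁻¹ (α (letter x))⁻¹ (α (letter y))
        omega

theorem gromov_and_norm_mk (hmin : NielsenMinimal α) (y : Fin 2 × Bool) (w : List (Fin 2 × Bool))
    (hw : FreeGroup.IsReduced (y :: w)) (z : Fin 2 × Bool) (hz : z ≠ inv' y) :
    gromov (α (letter z))⁻¹ (α (FreeGroup.mk (y :: w))) =
        gromov (α (letter z))⁻¹ (α (letter y)) ∧
      (y :: w).length + gromov (α (letter z))⁻¹ (α (letter y)) ≤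
        FreeGroup.norm (α (FreeGroup.mk (y :: w))) := by
  induction w generalizing y z with
  | nil =>
    refine ⟨rfl, ?_⟩
    have hy : y ≠ inv' y := fun h => by
      have := congrArg Prod.snd h
      simp [inv'] at this
    have := gromov_add_gromov_lt hmin hz hy
    change _ ≤ FreeGroup.norm (α (letter y))
    simp
    omega
  | cons x w ih =>
    have hyx : y ≠ inv' x := by
      rintro rfl
      have := (FreeGroup.isReduced_cons_cons.1 hw).1
      simp [inv'] at this
    obtain ⟨i1, i2⟩ := ih x (FreeGroup.isReduced_cons_cons.1 hw).2 y hyx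
    have e : α (FreeGroup.mk (y :: x :: w)) = α (letter y) * α (FreeGroup.mk (x :: w)) := by
      rw [← map_mul, letter, FreeGroup.mul_mk]
      rfl
    have h1 := norm_mul_add (α (letter y)) (α (FreeGroup.mk (x :: w)))
    have h2 := norm_inv_mul_add (α (letter y)) (α (FreeGroup.mk (y :: x :: w)))
    have h3 := gromov_add_gromov_lt hmin hz hyx
    have e2 : (α (letter y))⁻¹ * α (FreeGroup.mk (y :: x :: w)) = α (FreeGroup.mk (x :: w)) := by
      rw [e]
      group
    rw [e2] at h2
    rw [← e] at h1
    have h4 : gromov (α (letter z))⁻¹ (α (FreeGroup.mk (y :: x :: w))) =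
        gromov (α (letter z))⁻¹ (α (letter y)) := gromov_eq_of_lt (by omega)
    refine ⟨h4, ?_⟩
    simp only [List.length_cons] at i2 ⊢
    omega

theorem norm_le_norm_apply (hmin : NielsenMinimal α) (g : F) :
    FreeGroup.norm g ≤ FreeGroup.norm (α g) := by
  have hr := FreeGroup.isReduced_toWord (x := g)
  have e : g = FreeGroup.mk g.toWord := FreeGroup.mk_toWord.symm
  cases hw : g.toWord with
  | nil => simp [FreeGroup.norm, hw]
  | cons y w =>
    rw [hw] at hr e
    have hy : y ≠ inv' y := fun h => by
      have := congrArg Prod.snd h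
      simp [inv'] at this
    have := (gromov_and_norm_mk hmin y w hr y hy).2
    rw [← e] at this
    rw [FreeGroup.norm, hw]
    omega

theorem mem_nielsen_of_minimal (hmin : NielsenMinimal α) : α ∈ nielsen := by
  have key : ∀ i, ∃ x, α⁻¹ (FreeGroup.of i) = letter x := by
    intro i
    have h := norm_le_norm_apply hmin (α⁻¹ (FreeGroup.of i))
    rw [MulAut.apply_inv_self, FreeGroup.norm_of, FreeGroup.norm] at h
    have e : α⁻¹ (FreeGroup.of i) = FreeGroup.mk (α⁻¹ (FreeGroup.of i)).toWord :=
      FreeGroup.mk_toWord.symm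
    have hne : α⁻¹ (FreeGroup.of i) ≠ 1 := by
      rw [Ne, EmbeddingLike.map_eq_one_iff]
      exact FreeGroup.of_ne_one i
    generalize (α⁻¹ (FreeGroup.of i)).toWord = w at h e
    match w with
    | [] => exact absurd e hne
    | [x] => exact ⟨x, e⟩
    | _ :: _ :: _ => simp at h
  obtain ⟨x, hx⟩ := key 0
  obtain ⟨y, hy⟩ := key 1
  have hxy : x.1 ≠ y.1 := by
    intro h
    have hab : a ≠ b ∧ a ≠ b⁻¹ := by
      constructor
      · intro h
        have := congrArg FreeGroup.toWord h
        simp [a, b] at this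
      · intro h
        have := congrArg FreeGroup.toWord h
        simp [a, b, FreeGroup.toWord_inv, FreeGroup.invRev] at this
    rcases letter_eq_of_fst_eq h with rfl | rfl
    · exact hab.1 ((α⁻¹).injective (hx.trans hy.symm))
    · refine hab.2 ((α⁻¹).injective (hx.trans ?_))
      rw [letter_inv', ← hy, map_inv]
      rfl
  obtain ⟨σ, hσ, h1, h2⟩ := exists_nielsen_letters hxy
  have : σ = α⁻¹ := mulAut_ext (h1.trans hx.symm) (h2.trans hy.symm)
  rw [this] at hσ
  exact inv_mem_iff.1 hσ

end Minimal

theorem nielsen_eq_top : nielsen = ⊤ := by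
  rw [eq_top_iff]
  intro α _
  induction h : basisLength α using Nat.strong_induction_on generalizing α with
  | _ n ih =>
    by_cases hmin : ∀ γ ∈ nielsen, basisLength α ≤ basisLength (α * γ)
    · exact mem_nielsen_of_minimal hmin
    · push Not at hmin
      obtain ⟨γ, hγ, hlt⟩ := hmin
      exact (nielsen.mul_mem_cancel_right hγ).1 (ih _ (h ▸ hlt) (Subgroup.mem_top _) rfl)

/-- An induction principle for automorphisms of `F`. -/
theorem mulAut_induction {P : MulAut F → Prop} (hflip : P flipA) (hswap : P swapAB)
    (htransv : P transv) (hconj : ∀ g, P (MulAut.conj g)) (hone : P 1)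
    (hmul : ∀ α β, P α → P β → P (α * β)) (α : MulAut F) : P α := by
  have hinv : transv⁻¹ = MulAut.conj b * (flipA * transv * flipA) := by
    rw [inv_eq_iff_mul_eq_one]
    refine mulAut_ext ?_ ?_ <;> simp [mul_assoc]
  have hα : α ∈ (nielsen.toSubmonoid) := by
    rw [nielsen_eq_top]
    trivial
  rw [nielsen, Subgroup.closure_toSubmonoid] at hα
  refine Submonoid.closure_induction (motive := fun α _ => P α) ?_ hone (fun α β _ _ => hmul α β) hα
  rintro β (hβ | hβ)
  · rcases hβ with (rfl | rfl | rfl) | ⟨g, rfl⟩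
    exacts [hflip, hswap, htransv, hconj g]
  · rw [Set.mem_inv] at hβ
    rcases hβ with (h | h | h) | ⟨g, h⟩
    · have : β = flipA := by
        rw [inv_eq_iff_eq_inv.1 h, inv_eq_iff_mul_eq_one]
        refine mulAut_ext ?_ ?_ <;> simp
      rwa [this]
    · have : β = swapAB := by
        rw [inv_eq_iff_eq_inv.1 h, inv_eq_iff_mul_eq_one]
        refine mulAut_ext ?_ ?_ <;> simp
      rwa [this]
    · rw [inv_eq_iff_eq_inv.1 h, hinv]
      exact hmul _ _ (hconj _) (hmul _ _ (hmul _ _ hflip htransv) hflip)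
    · rw [inv_eq_iff_eq_inv.1 h.symm, ← map_inv]
      exact hconj _

/-! ### The commutator of the generators -/

theorem apply_commAB (α : MulAut F) :
    IsConj (α commAB) commAB ∨ IsConj (α commAB) commAB⁻¹ := by
  induction α using mulAut_induction with
  | hflip =>
    right
    exact isConj_iff.2 ⟨a, by simp [commAB]; group⟩
  | hswap =>
    right
    exact isConj_iff.2 ⟨1, by simp [commAB]; group⟩
  | htransv =>
    left
    exact isConj_iff.2 ⟨1, by simp [commAB, mul_assoc]⟩
  | hconj g => exact .inl (isConj_iff.2 ⟨g⁻¹, by simp; group⟩)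
  | hone => exact .inl (IsConj.refl _)
  | hmul α β hα hβ =>
    have hinv : ∀ {g h : F}, IsConj g h → IsConj g⁻¹ h⁻¹ := by
      intro g h hgh
      obtain ⟨c, rfl⟩ := isConj_iff.1 hgh
      exact isConj_iff.2 ⟨c, by group⟩
    have hα' : ∀ {g h : F}, IsConj g h → IsConj (α g) (α h) :=
      fun hgh => α.toMonoidHom.map_isConj hgh
    rcases hβ with hβ | hβ
    · exact hα.imp (hα' hβ).trans (hα' hβ).trans
    · have := hα' hβ
      rw [map_inv] at this
      rcases hα with hα | hα
      · exact .inr (this.trans (hinv hα))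
      · exact .inl (this.trans (by simpa using hinv hα))

theorem exists_isConj_zpow_apply (α : MulAut F) {g : F} (h : ∃ k : ℤ, IsConj g (commAB ^ k)) :
    ∃ k : ℤ, IsConj (α g) (commAB ^ k) := by
  obtain ⟨k, hk⟩ := h
  have h1 : IsConj (α g) ((α commAB) ^ k) := by
    simpa using α.toMonoidHom.map_isConj hk
  have hpow : ∀ {x y : F}, IsConj x y → IsConj (x ^ k) (y ^ k) := by
    intro x y hxy
    obtain ⟨c, rfl⟩ := isConj_iff.1 hxy
    exact isConj_iff.2 ⟨c, by rw [conj_zpow]⟩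
  rcases apply_commAB α with h | h
  · exact ⟨k, h1.trans (hpow h)⟩
  · exact ⟨-k, h1.trans (by simpa using hpow h)⟩

/-! ### Cyclically reduced words -/

theorem isReduced_iff_ne_inv' {w : List (Fin 2 × Bool)} :
    FreeGroup.IsReduced w ↔ w.IsChain fun x y => y ≠ inv' x := by
  have e : (fun x y : Fin 2 × Bool => x.1 = y.1 → x.2 = y.2) = fun x y => y ≠ inv' x := by
    ext ⟨i, c⟩ ⟨j, d⟩
    cases c <;> cases d <;> simp [inv', eq_comm]
  rw [FreeGroup.IsReduced, e]

theorem isCyclicallyReduced_iff_ne_inv' {w : List (Fin 2 × Bool)} :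
    FreeGroup.IsCyclicallyReduced w ↔ (w.IsChain fun x y => y ≠ inv' x) ∧
      ∀ x ∈ w.getLast?, ∀ y ∈ w.head?, y ≠ inv' x := by
  rw [FreeGroup.IsCyclicallyReduced, isReduced_iff_ne_inv']
  refine and_congr_right fun _ => forall₄_congr fun x _ y _ => ?_
  obtain ⟨i, c⟩ := x
  obtain ⟨j, d⟩ := y
  cases c <;> cases d <;> simp [inv', eq_comm]

theorem isCyclicallyReduced_rotate {u v : List (Fin 2 × Bool)}
    (h : FreeGroup.IsCyclicallyReduced (u ++ v)) : FreeGroup.IsCyclicallyReduced (v ++ u) := by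
  rw [isCyclicallyReduced_iff_ne_inv'] at h ⊢
  rw [List.isChain_append] at h ⊢
  obtain ⟨⟨h1, h2, h3⟩, h4⟩ := h
  by_cases hu : u = []
  · simp_all
  by_cases hv : v = []
  · simp_all
  rw [List.getLast?_append_of_ne_nil _ hv, List.head?_append_of_ne_nil _ hu] at h4
  rw [List.getLast?_append_of_ne_nil _ hu, List.head?_append_of_ne_nil _ hv]
  exact ⟨⟨h2, h1, h4⟩, h3⟩

theorem isCyclicallyReduced_toWord {g : F} (h : IsCyclicallyReduced g) :
    FreeGroup.IsCyclicallyReduced g.toWord := by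
  have e := FreeGroup.reduceCyclically.conj_conjugator_reduceCyclically g.toWord
  have hr := FreeGroup.reduceCyclically.isCyclicallyReduced (FreeGroup.isReduced_toWord (x := g))
  set c := FreeGroup.reduceCyclically.conjugator g.toWord
  set r := FreeGroup.reduceCyclically g.toWord
  have e2 : g = FreeGroup.mk c * FreeGroup.mk r * (FreeGroup.mk c)⁻¹ := by
    rw [FreeGroup.inv_mk, FreeGroup.mul_mk, FreeGroup.mul_mk, e, FreeGroup.mk_toWord]
  have h1 := h (FreeGroup.mk c)⁻¹
  have e3 : (FreeGroup.mk c)⁻¹ * g * (FreeGroup.mk c)⁻¹⁻¹ = FreeGroup.mk r := by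
    rw [e2]
    group
  rw [e3, norm_mk_of_isReduced hr.isReduced, FreeGroup.norm, ← e] at h1
  simp at h1
  have hc : c = [] := List.eq_nil_of_length_eq_zero (by omega)
  rw [← e, hc]
  simpa using hr

/-! ### Height functions -/

/-- The height of an element with respect to a homomorphism to the integers. -/
def ht (φ : F →* Multiplicative ℤ) (g : F) : ℤ := (φ g).toAdd

section Height

variable (φ : F →* Multiplicative ℤ)

@[simp] theorem ht_one : ht φ 1 = 0 := by simp [ht]
@[simp] theorem ht_mul (g h : F) : ht φ (g * h) = ht φ g + ht φ h := by simp [ht]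
@[simp] theorem ht_inv (g : F) : ht φ g⁻¹ = -ht φ g := by simp [ht]
@[simp] theorem ht_inv_hom (g : F) : ht φ⁻¹ g = -ht φ g := by simp [ht]

theorem ht_comp (θ : F →* F) (g : F) : ht (φ.comp θ) g = ht φ (θ g) := rfl

@[simp] theorem ht_mk_nil : ht φ (FreeGroup.mk []) = 0 := ht_one φ

theorem mk_cons (x : Fin 2 × Bool) (w : List (Fin 2 × Bool)) :
    FreeGroup.mk (x :: w) = letter x * FreeGroup.mk w := by
  rw [letter, FreeGroup.mul_mk]
  rfl

@[simp] theorem ht_mk_cons (x : Fin 2 × Bool) (w : List (Fin 2 × Bool)) :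
    ht φ (FreeGroup.mk (x :: w)) = ht φ (letter x) + ht φ (FreeGroup.mk w) := by
  rw [mk_cons, ht_mul]

@[simp] theorem ht_mk_append (u v : List (Fin 2 × Bool)) :
    ht φ (FreeGroup.mk (u ++ v)) = ht φ (FreeGroup.mk u) + ht φ (FreeGroup.mk v) := by
  rw [← FreeGroup.mul_mk, ht_mul]

@[simp] theorem ht_inv' (x : Fin 2 × Bool) : ht φ (letter (inv' x)) = -ht φ (letter x) := by
  rw [letter_inv', ht_inv]

theorem ht_eq_of_isConj {g h : F} (hgh : IsConj g h) : ht φ g = ht φ h := by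
  obtain ⟨c, rfl⟩ := isConj_iff.1 hgh
  simp

theorem ht_eq_zero_of_mem_commutator {g : F} (hg : g ∈ commutator F) : ht φ g = 0 := by
  have := Abelianization.commutator_subset_ker φ hg
  rw [MonoidHom.mem_ker] at this
  simp [ht, this]

/-! ### Words staying in a strip -/

/-- The path spelled by a word, starting at height `h`, stays between the heights `0` and `n`. -/
def Strip (n : ℤ) : ℤ → List (Fin 2 × Bool) → Prop
  | h, [] => 0 ≤ h ∧ h ≤ n
  | h, x :: w => (0 ≤ h ∧ h ≤ n) ∧ Strip n (h + ht φ (letter x)) w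

variable {φ} {n : ℤ}

theorem Strip.start {h : ℤ} {w : List (Fin 2 × Bool)} (hw : Strip φ n h w) : 0 ≤ h ∧ h ≤ n := by
  cases w with
  | nil => exact hw
  | cons x w => exact hw.1

theorem strip_append {h : ℤ} {u v : List (Fin 2 × Bool)} :
    Strip φ n h (u ++ v) ↔ Strip φ n h u ∧ Strip φ n (h + ht φ (FreeGroup.mk u)) v := by
  induction u generalizing h with
  | nil => simpa [Strip] using fun hv => Strip.start hv
  | cons x u ih => simp [Strip, ih, and_assoc, add_assoc]

theorem strip_iff {h : ℤ} {w : List (Fin 2 × Bool)} : Strip φ n h w ↔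
    ∀ u, u <+: w → 0 ≤ h + ht φ (FreeGroup.mk u) ∧ h + ht φ (FreeGroup.mk u) ≤ n := by
  induction w generalizing h with
  | nil => simp [Strip]
  | cons x w ih =>
    simp only [Strip, ih, List.prefix_cons_iff]
    constructor
    · rintro ⟨h1, h2⟩ u (rfl | ⟨t, rfl, ht⟩)
      · simpa using h1
      · simpa [add_assoc] using h2 t ht
    · intro H
      exact ⟨by simpa using H [] (.inl rfl),
        fun u hu => by simpa [add_assoc] using H _ (.inr ⟨u, rfl, hu⟩)⟩

theorem Strip.reduce {h : ℤ} {w : List (Fin 2 × Bool)} (hw : Strip φ n h w) :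
    Strip φ n h (FreeGroup.reduce w) := by
  induction w generalizing h with
  | nil => exact hw
  | cons x w ih =>
    have h1 := ih hw.2
    rw [FreeGroup.reduce.cons]
    cases hr : FreeGroup.reduce w with
    | nil =>
      rw [hr] at h1
      exact ⟨hw.1, h1⟩
    | cons y t =>
      rw [hr] at h1
      dsimp only
      split_ifs with hxy
      · have : x = inv' y := Prod.ext hxy.1 hxy.2
        have h2 := h1.2
        rw [this, ht_inv', add_assoc, neg_add_cancel, add_zero] at h2
        exact h2
      · exact ⟨hw.1, h1⟩

theorem Strip.invRev {h : ℤ} {w : List (Fin 2 × Bool)} (hw : Strip φ n h w) :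
    Strip φ n (h + ht φ (FreeGroup.mk w)) (FreeGroup.invRev w) := by
  induction w generalizing h with
  | nil => simpa [FreeGroup.invRev] using hw
  | cons x w ih =>
    have h1 := ih hw.2
    have e : FreeGroup.invRev (x :: w) = FreeGroup.invRev w ++ [inv' x] := by
      simp [FreeGroup.invRev, inv']
    rw [e, strip_append, ht_mk_cons, ← add_assoc]
    refine ⟨h1, ?_⟩
    rw [← FreeGroup.inv_mk, ht_inv]
    have h2 := hw.1
    have h3 := hw.2.start
    simp only [Strip, ht_inv']
    omega

theorem Strip.inv_hom {h : ℤ} {w : List (Fin 2 × Bool)} (hw : Strip φ n h w) :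
    Strip φ⁻¹ n (n - h) w := by
  rw [strip_iff] at hw ⊢
  intro u hu
  have := hw u hu
  rw [ht_inv_hom]
  omega

variable (φ n) in
/-- The path spelled by the reduced word of an element stays in a strip. -/
def StripEl (h : ℤ) (g : F) : Prop := Strip φ n h g.toWord

theorem StripEl.mul {h : ℤ} {g k : F} (hg : StripEl φ n h g) (hk : StripEl φ n (h + ht φ g) k) :
    StripEl φ n h (g * k) := by
  rw [StripEl, FreeGroup.toWord_mul]
  refine Strip.reduce (strip_append.2 ⟨hg, ?_⟩)
  rwa [FreeGroup.mk_toWord]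

theorem StripEl.inv {h k : ℤ} {g : F} (hg : StripEl φ n h g) (hk : k = h + ht φ g) :
    StripEl φ n k g⁻¹ := by
  rw [StripEl, FreeGroup.toWord_inv, hk]
  simpa [FreeGroup.mk_toWord] using Strip.invRev hg

theorem StripEl.inv_hom {h : ℤ} {g : F} (hg : StripEl φ n h g) : StripEl φ⁻¹ n (n - h) g :=
  Strip.inv_hom hg

theorem stripEl_one {h : ℤ} : StripEl φ n h 1 ↔ 0 ≤ h ∧ h ≤ n := by
  simp [StripEl, Strip]

theorem stripEl_letter {h : ℤ} {x : Fin 2 × Bool} : StripEl φ n h (letter x) ↔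
    (0 ≤ h ∧ h ≤ n) ∧ 0 ≤ h + ht φ (letter x) ∧ h + ht φ (letter x) ≤ n := by
  have e : (letter x).toWord = [x] := FreeGroup.toWord_mk.trans (FreeGroup.reduce_singleton x)
  rw [StripEl, e, Strip, Strip]

theorem stripEl_a {h : ℤ} : StripEl φ n h a ↔
    (0 ≤ h ∧ h ≤ n) ∧ 0 ≤ h + ht φ a ∧ h + ht φ a ≤ n := stripEl_letter (x := (0, true))

theorem stripEl_b {h : ℤ} : StripEl φ n h b ↔
    (0 ≤ h ∧ h ≤ n) ∧ 0 ≤ h + ht φ b ∧ h + ht φ b ≤ n := stripEl_letter (x := (1, true))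

theorem stripEl_a_inv {h : ℤ} : StripEl φ n h a⁻¹ ↔
    (0 ≤ h ∧ h ≤ n) ∧ 0 ≤ h - ht φ a ∧ h - ht φ a ≤ n := by
  rw [sub_eq_add_neg, ← ht_inv]
  exact stripEl_letter (x := (0, false))

theorem stripEl_b_inv {h : ℤ} : StripEl φ n h b⁻¹ ↔
    (0 ≤ h ∧ h ≤ n) ∧ 0 ≤ h - ht φ b ∧ h - ht φ b ≤ n := by
  rw [sub_eq_add_neg, ← ht_inv]
  exact stripEl_letter (x := (1, false))

/-- A path in a strip is mapped by a homomorphism, corrected by a choice of path at every height,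
to a path in another strip, as soon as this holds for the generators. -/
theorem Strip.gauge {φ φ' : F →* Multiplicative ℤ} {n n' : ℤ} {θ : F →* F} {γ : ℤ → F} {L : ℤ → ℤ}
    (hL : ∀ h, 0 ≤ h → h ≤ n → 0 ≤ L h ∧ L h ≤ n')
    (hht : ∀ g h, L h + ht φ' ((γ h)⁻¹ * θ g * γ (h + ht φ g)) = L (h + ht φ g))
    (ha : ∀ h, 0 ≤ h → h ≤ n → 0 ≤ h + ht φ a → h + ht φ a ≤ n →
      StripEl φ' n' (L h) ((γ h)⁻¹ * θ a * γ (h + ht φ a)))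
    (hb : ∀ h, 0 ≤ h → h ≤ n → 0 ≤ h + ht φ b → h + ht φ b ≤ n →
      StripEl φ' n' (L h) ((γ h)⁻¹ * θ b * γ (h + ht φ b)))
    {h : ℤ} {w : List (Fin 2 × Bool)} (hw : Strip φ n h w) :
    StripEl φ' n' (L h)
      ((γ h)⁻¹ * θ (FreeGroup.mk w) * γ (h + ht φ (FreeGroup.mk w))) := by
  have hgen : ∀ i h, 0 ≤ h → h ≤ n → 0 ≤ h + ht φ (letter (i, true)) →
      h + ht φ (letter (i, true)) ≤ n → StripEl φ' n' (L h)
        ((γ h)⁻¹ * θ (letter (i, true)) * γ (h + ht φ (letter (i, true)))) := by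
    intro i
    fin_cases i
    exacts [ha, hb]
  have hlet : ∀ x h, 0 ≤ h → h ≤ n → 0 ≤ h + ht φ (letter x) →
      h + ht φ (letter x) ≤ n → StripEl φ' n' (L h)
        ((γ h)⁻¹ * θ (letter x) * γ (h + ht φ (letter x))) := by
    rintro ⟨i, _ | _⟩ h h1 h2 h3 h4
    · have e : letter (i, false) = (letter (i, true))⁻¹ := letter_inv' (i, true)
      rw [e, ht_inv] at h3 h4 ⊢
      have := (hgen i _ h3 h4 (by omega) (by omega)).inv (hht _ _).symm
      rw [neg_add_cancel_right] at this
      convert this using 1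
      rw [map_inv]
      group
    · exact hgen i h h1 h2 h3 h4
  induction w generalizing h with
  | nil =>
    have e : (FreeGroup.mk [] : F) = 1 := rfl
    rw [e]
    simpa [stripEl_one] using hL h hw.1 hw.2
  | cons x w ih =>
    have h1 := hw.1
    have h2 := hw.2.start
    have h3 := hlet x h h1.1 h1.2 h2.1 h2.2
    have h4 := ih hw.2
    rw [← hht] at h4
    convert h3.mul h4 using 1
    rw [ht_mk_cons, mk_cons, map_mul]
    group

end Height

/-! ### Conjugacy classes in strips of minimal width -/

/-- Some conjugate of `g` stays in a strip whose width is the sum of the slopes of the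
generators. -/
def Narrow (φ : F →* Multiplicative ℤ) (g : F) : Prop :=
  ∃ g', IsConj g g' ∧ ∃ h, StripEl φ (|ht φ a| + |ht φ b|) h g'

theorem Narrow.inv_hom {φ : F →* Multiplicative ℤ} {g : F} (hg : Narrow φ g) :
    Narrow φ⁻¹ g := by
  obtain ⟨g', h1, h, h2⟩ := hg
  refine ⟨g', h1, _, by simpa using h2.inv_hom⟩

theorem narrow_inv_hom {φ : F →* Multiplicative ℤ} {g : F} : Narrow φ⁻¹ g ↔ Narrow φ g :=
  ⟨fun h => by simpa using h.inv_hom, Narrow.inv_hom⟩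

/-- The gauge transformation for paths, when the change of heights is determined by the correction
paths up to a constant. -/
theorem Strip.gauge_shift {φ φ' : F →* Multiplicative ℤ} {n n' : ℤ} {θ : F →* F} (γ : ℤ → F)
    (s : ℤ) (hφ : φ'.comp θ = φ)
    (hL : ∀ h, 0 ≤ h → h ≤ n → 0 ≤ h + s + ht φ' (γ h) ∧ h + s + ht φ' (γ h) ≤ n')
    (ha : ∀ h, 0 ≤ h → h ≤ n → 0 ≤ h + ht φ a → h + ht φ a ≤ n →
      StripEl φ' n' (h + s + ht φ' (γ h)) ((γ h)⁻¹ * θ a * γ (h + ht φ a)))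
    (hb : ∀ h, 0 ≤ h → h ≤ n → 0 ≤ h + ht φ b → h + ht φ b ≤ n →
      StripEl φ' n' (h + s + ht φ' (γ h)) ((γ h)⁻¹ * θ b * γ (h + ht φ b)))
    {h : ℤ} {w : List (Fin 2 × Bool)} (hw : Strip φ n h w) :
    StripEl φ' n' (h + s + ht φ' (γ h))
      ((γ h)⁻¹ * θ (FreeGroup.mk w) * γ (h + ht φ (FreeGroup.mk w))) := by
  refine Strip.gauge (L := fun h => h + s + ht φ' (γ h)) hL (fun g h => ?_) ha hb hw
  rw [← hφ]
  simp only [ht_mul, ht_inv, ht_comp]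
  ring

theorem Narrow.apply_of_gauge {φ φ' : F →* Multiplicative ℤ} {θ : F →* F} {g : F}
    (hg : Narrow φ g) (γ : ℤ → F)
    (s : ℤ) (hφ : φ'.comp θ = φ) (hg0 : ht φ g = 0)
    (hL : ∀ h, 0 ≤ h → h ≤ |ht φ a| + |ht φ b| →
      0 ≤ h + s + ht φ' (γ h) ∧ h + s + ht φ' (γ h) ≤ |ht φ' a| + |ht φ' b|)
    (ha : ∀ h, 0 ≤ h → h ≤ |ht φ a| + |ht φ b| → 0 ≤ h + ht φ a →
      h + ht φ a ≤ |ht φ a| + |ht φ b| → StripEl φ' (|ht φ' a| + |ht φ' b|)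
        (h + s + ht φ' (γ h)) ((γ h)⁻¹ * θ a * γ (h + ht φ a)))
    (hb : ∀ h, 0 ≤ h → h ≤ |ht φ a| + |ht φ b| → 0 ≤ h + ht φ b →
      h + ht φ b ≤ |ht φ a| + |ht φ b| → StripEl φ' (|ht φ' a| + |ht φ' b|)
        (h + s + ht φ' (γ h)) ((γ h)⁻¹ * θ b * γ (h + ht φ b))) :
    Narrow φ' (θ g) := by
  obtain ⟨g', h1, h, h2⟩ := hg
  have h3 := Strip.gauge_shift γ s hφ hL ha hb h2
  rw [FreeGroup.mk_toWord, ← ht_eq_of_isConj φ h1, hg0, add_zero] at h3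
  exact ⟨_, (θ.map_isConj h1).trans (isConj_iff.2 ⟨(γ h)⁻¹, by group⟩), _, h3⟩

theorem Narrow.flipA {φ : F →* Multiplicative ℤ} {g : F}
    (hg : Narrow (φ.comp flipA.toMonoidHom) g) (hg0 : ht φ (flipA g) = 0) :
    Narrow φ (flipA g) := by
  refine Narrow.apply_of_gauge (θ := FreeGroupRankTwo.flipA.toMonoidHom) hg (fun _ => 1) 0 rfl hg0
    ?_ ?_ ?_
  all_goals
    simp [ht_comp, stripEl_a_inv, stripEl_b]
    try omega

theorem Narrow.swapAB {φ : F →* Multiplicative ℤ} {g : F}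
    (hg : Narrow (φ.comp swapAB.toMonoidHom) g) (hg0 : ht φ (swapAB g) = 0) :
    Narrow φ (swapAB g) := by
  refine Narrow.apply_of_gauge (θ := FreeGroupRankTwo.swapAB.toMonoidHom) hg (fun _ => 1) 0 rfl hg0
    ?_ ?_ ?_
  all_goals
    simp [ht_comp, stripEl_a, stripEl_b]
    try omega

theorem Narrow.transv_of_nonneg {φ : F →* Multiplicative ℤ} {g : F}
    (hg : Narrow (φ.comp transv.toMonoidHom) g) (hg0 : ht φ (transv g) = 0) (hq : 0 ≤ ht φ b) :
    Narrow φ (transv g) := by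
  have ea : ht (φ.comp transv.toMonoidHom) a = ht φ a + ht φ b := by simp [ht_comp]
  have eb : ht (φ.comp transv.toMonoidHom) b = ht φ b := by simp [ht_comp]
  have ta : transv.toMonoidHom a = a * b := transv_a
  have tb : transv.toMonoidHom b = b := transv_b
  rcases le_or_gt (ht φ a + ht φ b) 0 with h1 | h1
  · refine Narrow.apply_of_gauge (θ := transv.toMonoidHom) hg (fun _ => 1) (ht φ b) rfl hg0
      ?_ ?_ ?_
    all_goals
      rw [ea, eb]
      intro h
      rw [abs_of_nonpos h1, abs_of_nonneg hq, abs_of_nonpos (by omega : ht φ a ≤ 0)]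
    · simp
      omega
    · intro _ _ _ _
      rw [ta, inv_one, one_mul, mul_one]
      apply StripEl.mul
      · rw [stripEl_a, ht_one]
        omega
      · rw [stripEl_b, ht_one]
        omega
    · intro _ _ _ _
      rw [tb, inv_one, one_mul, mul_one, stripEl_b, ht_one]
      omega
  rcases le_or_gt 0 (ht φ a) with h2 | h2
  · refine Narrow.apply_of_gauge (θ := transv.toMonoidHom) hg
      (fun h => if ht φ a + ht φ b < h then b⁻¹ else 1) 0 rfl hg0 ?_ ?_ ?_
    all_goals
      rw [ea, eb]
      intro h
      rw [abs_of_nonneg h1.le, abs_of_nonneg hq, abs_of_nonneg h2]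
    · split_ifs <;> simp <;> omega
    · intro _ _ _ _
      rw [if_neg (by omega), ta, inv_one, one_mul]
      split_ifs
      · rw [mul_inv_cancel_right, stripEl_a, ht_one]
        omega
      · rw [mul_one]
        apply StripEl.mul
        · rw [stripEl_a, ht_one]
          omega
        · rw [stripEl_b, ht_one]
          omega
    · intro _ _ _ _
      rw [if_neg (by omega), tb, inv_one, one_mul]
      split_ifs
      · rw [mul_inv_cancel, stripEl_one, ht_one]
        omega
      · rw [mul_one, stripEl_b, ht_one]
        omega
  · refine Narrow.apply_of_gauge (θ := transv.toMonoidHom) hg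
      (fun h => if ht φ b < h then b⁻¹ * a⁻¹ else 1) (-ht φ a) rfl hg0 ?_ ?_ ?_
    all_goals
      rw [ea, eb]
      intro h
      rw [abs_of_nonneg h1.le, abs_of_nonneg hq, abs_of_nonpos h2.le]
    · split_ifs <;> simp <;> omega
    · intro _ _ _ _
      rw [if_neg (by omega), ta, inv_one, one_mul]
      split_ifs
      · rw [← mul_inv_rev, mul_inv_cancel, stripEl_one, ht_one]
        omega
      · rw [mul_one]
        apply StripEl.mul
        · rw [stripEl_a, ht_one]
          omega
        · rw [stripEl_b, ht_one]
          omega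
    · intro _ _ _ _
      rw [if_neg (by omega), tb, inv_one, one_mul]
      split_ifs
      · rw [mul_inv_cancel_left, stripEl_a_inv, ht_one]
        omega
      · rw [mul_one, stripEl_b, ht_one]
        omega

theorem Narrow.apply (α : MulAut F) {φ : F →* Multiplicative ℤ} {g : F}
    (hg : Narrow (φ.comp α.toMonoidHom) g) (hg0 : ht φ (α g) = 0) : Narrow φ (α g) := by
  induction α using mulAut_induction generalizing φ g with
  | hflip => exact hg.flipA hg0
  | hswap => exact hg.swapAB hg0
  | htransv =>
    rcases le_total 0 (ht φ b) with h | h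
    · exact hg.transv_of_nonneg hg0 h
    · rw [← narrow_inv_hom]
      refine Narrow.transv_of_nonneg ?_ (by simpa using hg0) (by simpa using h)
      exact hg.inv_hom
  | hconj c =>
    have e : φ.comp (MulAut.conj c).toMonoidHom = φ := by
      ext x
      simp
    rw [e] at hg
    obtain ⟨g', h1, h2⟩ := hg
    refine ⟨g', IsConj.trans (isConj_iff.2 ⟨c⁻¹, ?_⟩) h1, h2⟩
    simp
    group
  | hone => exact hg
  | hmul α β hα hβ =>
    have h1 : Narrow (φ.comp α.toMonoidHom) (β g) := hβ hg hg0
    exact hα h1 hg0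

theorem strip_of_stripEl_conj {φ : F →* Multiplicative ℤ} {n : ℤ} (c : List (Fin 2 × Bool))
    (hc : FreeGroup.IsReduced c) {r : List (Fin 2 × Bool)} (hr : FreeGroup.IsCyclicallyReduced r)
    (hr0 : ht φ (FreeGroup.mk r) = 0) {h : ℤ}
    (hs : StripEl φ n h ((FreeGroup.mk c)⁻¹ * FreeGroup.mk r * FreeGroup.mk c)) :
    ∃ h', Strip φ n h' r := by
  induction c generalizing r with
  | nil =>
    have e : (FreeGroup.mk [] : F) = 1 := rfl
    rw [e, inv_one, one_mul, mul_one, StripEl, FreeGroup.toWord_mk, hr.isReduced.reduce_eq] at hs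
    exact ⟨h, hs⟩
  | cons x c ih =>
    rcases r.eq_nil_or_concat with rfl | ⟨r', y, rfl⟩
    · exact ⟨h, hs.start⟩
    rw [List.concat_eq_append] at hr hr0 hs ⊢
    by_cases hy : x = inv' y
    · have e : FreeGroup.mk (r' ++ [y]) = FreeGroup.mk r' * letter y := by
        rw [letter, FreeGroup.mul_mk]
      rw [e] at hr0
      have := ih (List.isChain_cons.1 hc).2 (isCyclicallyReduced_rotate hr)
        (r := y :: r') (by rw [mk_cons]; simpa [add_comm] using hr0) (by
          convert hs using 1
          rw [e, mk_cons, mk_cons, hy, letter_inv']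
          group)
      obtain ⟨h', hh⟩ := this
      refine ⟨h' + ht φ (letter y), strip_append.2 ⟨hh.2, ?_⟩⟩
      have h1 := hh.1
      simp only [ht_mul] at hr0
      have h2 := hh.2.start
      simp only [Strip]
      omega
    · cases hr' : r' ++ [y] with
      | nil => simp at hr'
      | cons z t =>
        by_cases hz : z = x
        · subst hz
          rw [hr'] at hr hs hr0
          rw [ht_mk_cons] at hr0
          have := ih (List.isChain_cons.1 hc).2
            (isCyclicallyReduced_rotate (u := [z]) hr) (by simp; omega) (by
              convert hs using 1
              rw [mk_cons, mk_cons, ← FreeGroup.mul_mk]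
              change _ * (FreeGroup.mk t * letter z) * _ = _
              group)
          obtain ⟨h', hh⟩ := this
          rw [strip_append] at hh
          have h1 := hh.2
          simp only [Strip] at h1
          refine ⟨h' - ht φ (letter z), by omega, ?_⟩
          rw [sub_add_cancel]
          exact hh.1
        · have hred : FreeGroup.IsReduced
              (FreeGroup.invRev (x :: c) ++ ((r' ++ [y]) ++ (x :: c))) := by
            have h1 : FreeGroup.IsReduced (FreeGroup.invRev (x :: c)) := by
              rw [FreeGroup.isReduced_iff_reduce_eq, FreeGroup.reduce_invRev, hc.reduce_eq]
            have h2 := hr.isReduced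
            have h3 : FreeGroup.invRev (x :: c) = FreeGroup.invRev c ++ [inv' x] := by
              simp [FreeGroup.invRev, inv']
            have h4 : inv' (inv' x) = x := by simp [inv']
            rw [isReduced_iff_ne_inv'] at h1 h2 hc ⊢
            rw [List.isChain_append, List.isChain_append]
            refine ⟨h1, ⟨h2, hc, by simpa using hy⟩, ?_⟩
            rw [h3, hr']
            simpa [h4] using hz
          rw [FreeGroup.inv_mk, mul_assoc, FreeGroup.mul_mk, FreeGroup.mul_mk, StripEl,
            FreeGroup.toWord_mk, hred.reduce_eq, strip_append, strip_append] at hs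
          rw [← hr']
          exact ⟨_, hs.2.1⟩

theorem Narrow.strip {φ : F →* Multiplicative ℤ} {g : F} (hg : Narrow φ g)
    (hc : IsCyclicallyReduced g) (h0 : ht φ g = 0) :
    ∃ h, Strip φ (|ht φ a| + |ht φ b|) h g.toWord := by
  obtain ⟨g', h1, h, h2⟩ := hg
  obtain ⟨c, rfl⟩ := isConj_iff.1 h1
  refine strip_of_stripEl_conj c⁻¹.toWord FreeGroup.isReduced_toWord
    (isCyclicallyReduced_toWord hc) (by rwa [FreeGroup.mk_toWord]) (h := h) ?_
  rwa [FreeGroup.mk_toWord, FreeGroup.mk_toWord, inv_inv]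

/-! ### Elements of minimal length in their orbit -/

/-- `g` has minimal length in its orbit under the automorphism group. -/
def OrbitMin (g : F) : Prop := ∀ α : MulAut F, FreeGroup.norm g ≤ FreeGroup.norm (α g)

theorem OrbitMin.isCyclicallyReduced {g : F} (h : OrbitMin g) : IsCyclicallyReduced g :=
  fun c => h (MulAut.conj c)

theorem OrbitMin.apply {g : F} (h : OrbitMin g) {α : MulAut F}
    (hα : FreeGroup.norm (α g) ≤ FreeGroup.norm g) : OrbitMin (α g) := fun β =>
  hα.trans (h (β * α))

theorem apply_mem_commutator {g : F} (hg : g ∈ commutator F) (α : MulAut F) :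
    α g ∈ commutator F := by
  have h := Subgroup.Characteristic.fixed (H := commutator F) inferInstance α
  rw [← h] at hg
  exact hg

theorem norm_apply_le_of_letters {α : MulAut F} (ha : FreeGroup.norm (α a) ≤ 1)
    (hb : FreeGroup.norm (α b) ≤ 1) (g : F) : FreeGroup.norm (α g) ≤ FreeGroup.norm g := by
  have hx : ∀ x, FreeGroup.norm (α (letter x)) ≤ 1 := by
    rintro ⟨i, _ | _⟩
    · have e : letter (i, false) = (letter (i, true))⁻¹ := letter_inv' (i, true)
      rw [e, map_inv, FreeGroup.norm_inv_eq]
      fin_cases i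
      exacts [ha, hb]
    · fin_cases i
      exacts [ha, hb]
  have key : ∀ w, FreeGroup.norm (α (FreeGroup.mk w)) ≤ w.length := by
    intro w
    induction w with
    | nil =>
      have e : (FreeGroup.mk [] : F) = 1 := rfl
      simp [e]
    | cons x w ih =>
      rw [mk_cons, map_mul, List.length_cons]
      have := FreeGroup.norm_mul_le (α (letter x)) (α (FreeGroup.mk w))
      have := hx x
      omega
  have := key g.toWord
  rwa [FreeGroup.mk_toWord] at this

/-- Every element of minimal length which is narrow with respect to `φ` can be moved into `H`
without changing its length. -/
def Movable (φ : F →* Multiplicative ℤ) : Prop :=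
  ∀ g, OrbitMin g → g ∈ commutator F → Narrow φ g →
    ∃ α : MulAut F, FreeGroup.norm (α g) = FreeGroup.norm g ∧ α g ∈ H

theorem Movable.of_inv {φ : F →* Multiplicative ℤ} (h : Movable φ⁻¹) : Movable φ :=
  fun g h1 h2 h3 => h g h1 h2 h3.inv_hom

theorem Movable.comp {φ : F →* Multiplicative ℤ} (h : Movable φ) {τ : MulAut F}
    (hτ : ∀ g, OrbitMin g → g ∈ commutator F → Narrow (φ.comp τ.toMonoidHom) g →
      ∃ c, FreeGroup.norm (c * τ g * c⁻¹) ≤ FreeGroup.norm g) :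
    Movable (φ.comp τ.toMonoidHom) := by
  intro g h1 h2 h3
  obtain ⟨c, hc⟩ := hτ g h1 h2 h3
  have hc' : FreeGroup.norm ((MulAut.conj c * τ) g) ≤ FreeGroup.norm g := hc
  have hcomm := apply_mem_commutator h2 τ
  have h4 : Narrow φ (τ g) := h3.apply τ (ht_eq_zero_of_mem_commutator φ hcomm)
  obtain ⟨k, hk, hk'⟩ := h4
  obtain ⟨β, hβ, hβ'⟩ := h ((MulAut.conj c * τ) g) (h1.apply hc') (apply_mem_commutator h2 _)
    ⟨k, IsConj.trans (isConj_iff.2 ⟨c⁻¹, by simp; group⟩) hk, hk'⟩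
  exact ⟨β * (MulAut.conj c * τ), hβ.trans (le_antisymm hc' (h1 _)), hβ'⟩

theorem Movable.comp_letters {φ : F →* Multiplicative ℤ} (h : Movable φ) {τ : MulAut F}
    (ha : FreeGroup.norm (τ a) ≤ 1) (hb : FreeGroup.norm (τ b) ≤ 1) :
    Movable (φ.comp τ.toMonoidHom) :=
  h.comp fun g _ _ _ => ⟨1, by simpa using norm_apply_le_of_letters ha hb g⟩

theorem norm_a : FreeGroup.norm a = 1 := FreeGroup.norm_of 0

theorem norm_b : FreeGroup.norm b = 1 := FreeGroup.norm_of 1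

theorem Movable.comp_flipA {φ : F →* Multiplicative ℤ} (h : Movable φ) :
    Movable (φ.comp flipA.toMonoidHom) :=
  h.comp_letters (by simp [norm_a]) (by simp [norm_b])

theorem Movable.comp_swapAB {φ : F →* Multiplicative ℤ} (h : Movable φ) :
    Movable (φ.comp swapAB.toMonoidHom) :=
  h.comp_letters (by simp [norm_b]) (by simp [norm_a])

/-! ### The length estimate -/

theorem norm_add_norm_gauge_le {φ : F →* Multiplicative ℤ} {n : ℤ} {θ₁ θ₂ : F →* F}
    {γ₁ γ₂ : ℤ → F} {E : ℤ → Fin 2 → ℤ}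
    (hE : ∀ i h, 0 ≤ h → h ≤ n → 0 ≤ h + ht φ (letter (i, true)) →
      h + ht φ (letter (i, true)) ≤ n →
      (FreeGroup.norm ((γ₁ h)⁻¹ * θ₁ (letter (i, true)) * γ₁ (h + ht φ (letter (i, true)))) +
        FreeGroup.norm ((γ₂ h)⁻¹ * θ₂ (letter (i, true)) * γ₂ (h + ht φ (letter (i, true)))) : ℤ)
        ≤ 2 + E h i + E (h + ht φ (letter (i, true))) i)
    (hE' : ∀ x y h, 0 ≤ h → h ≤ n → 0 ≤ h + ht φ (letter y) → h + ht φ (letter y) ≤ n →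
      0 ≤ h - ht φ (letter x) → h - ht φ (letter x) ≤ n → y ≠ inv' x → E h x.1 + E h y.1 ≤ 0)
    {g : F} (hg : IsCyclicallyReduced g) (hg1 : g ≠ 1) (hg0 : ht φ g = 0) {h : ℤ}
    (hs : Strip φ n h g.toWord) :
    FreeGroup.norm ((γ₁ h)⁻¹ * θ₁ g * γ₁ h) + FreeGroup.norm ((γ₂ h)⁻¹ * θ₂ g * γ₂ h) ≤
      2 * FreeGroup.norm g := by
  have hlet : ∀ x h, 0 ≤ h → h ≤ n → 0 ≤ h + ht φ (letter x) → h + ht φ (letter x) ≤ n →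
      (FreeGroup.norm ((γ₁ h)⁻¹ * θ₁ (letter x) * γ₁ (h + ht φ (letter x))) +
        FreeGroup.norm ((γ₂ h)⁻¹ * θ₂ (letter x) * γ₂ (h + ht φ (letter x))) : ℤ)
        ≤ 2 + E h x.1 + E (h + ht φ (letter x)) x.1 := by
    rintro ⟨i, _ | _⟩ h h1 h2 h3 h4
    · have e : letter (i, false) = (letter (i, true))⁻¹ := letter_inv' (i, true)
      rw [e, ht_inv] at h3 h4 ⊢
      have := hE i _ h3 h4 (by omega) (by omega)
      rw [neg_add_cancel_right, ← FreeGroup.norm_inv_eq (x := (γ₁ _)⁻¹ * _ * _),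
        ← FreeGroup.norm_inv_eq (x := (γ₂ _)⁻¹ * _ * _)] at this
      simp only [mul_inv_rev, inv_inv, ← map_inv, ← mul_assoc] at this
      dsimp only
      omega
    · exact hE i h h1 h2 h3 h4
  have key : ∀ (w : List (Fin 2 × Bool)) (x y : Fin 2 × Bool) (h : ℤ), FreeGroup.IsReduced w →
      x ∈ w.head? → y ∈ w.getLast? → Strip φ n h w →
      (FreeGroup.norm ((γ₁ h)⁻¹ * θ₁ (FreeGroup.mk w) * γ₁ (h + ht φ (FreeGroup.mk w))) +
        FreeGroup.norm ((γ₂ h)⁻¹ * θ₂ (FreeGroup.mk w) * γ₂ (h + ht φ (FreeGroup.mk w))) : ℤ)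
        ≤ 2 * w.length + E h x.1 + E (h + ht φ (FreeGroup.mk w)) y.1 := by
    intro w
    induction w with
    | nil => simp
    | cons z w ih =>
      rintro x y h hr hx hy hw
      obtain rfl : z = x := by simpa using hx
      have h1 := hlet z h hw.1.1 hw.1.2 hw.2.start.1 hw.2.start.2
      cases w with
      | nil =>
        obtain rfl : z = y := by simpa using hy
        change _ ≤ _
        have e : FreeGroup.mk [z] = letter z := rfl
        rw [e]
        simp only [List.length_singleton]
        push_cast
        omega
      | cons z' w =>
        have hz : z' ≠ inv' z := by
          rw [isReduced_iff_ne_inv'] at hr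
          exact (List.isChain_cons_cons.1 hr).1
        have h2 := ih z' y (h + ht φ (letter z)) (FreeGroup.isReduced_cons_cons.1 hr).2 (by simp)
          (by simpa using hy) hw.2
        have h3 := hE' z z' _ hw.2.start.1 hw.2.start.2 hw.2.2.start.1 hw.2.2.start.2
          (by have := hw.1; omega) (by have := hw.1; omega) hz
        rw [mk_cons z, ht_mul, map_mul, map_mul, ← add_assoc h]
        set k := h + ht φ (letter z)
        set l := k + ht φ (FreeGroup.mk (z' :: w))
        have e : ∀ (u v : F) (γ : ℤ → F), (γ h)⁻¹ * (u * v) * γ l =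
            ((γ h)⁻¹ * u * γ k) * ((γ k)⁻¹ * v * γ l) := by
          intros
          group
        rw [e, e]
        have h4 := FreeGroup.norm_mul_le ((γ₁ h)⁻¹ * θ₁ (letter z) * γ₁ k)
          ((γ₁ k)⁻¹ * θ₁ (FreeGroup.mk (z' :: w)) * γ₁ l)
        have h5 := FreeGroup.norm_mul_le ((γ₂ h)⁻¹ * θ₂ (letter z) * γ₂ k)
          ((γ₂ k)⁻¹ * θ₂ (FreeGroup.mk (z' :: w)) * γ₂ l)
        rw [List.length_cons]
        push_cast
        omega
  have hc := isCyclicallyReduced_toWord hg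
  have hne : g.toWord ≠ [] := by simpa using hg1
  obtain ⟨x, hx⟩ : ∃ x, x ∈ g.toWord.head? := by
    cases hw : g.toWord with
    | nil => exact absurd hw hne
    | cons x w => exact ⟨x, by simp⟩
  obtain ⟨y, hy⟩ : ∃ y, y ∈ g.toWord.getLast? := ⟨_, List.getLast?_eq_getLast_of_ne_nil hne⟩
  have h1 := key _ x y h hc.isReduced hx hy hs
  rw [FreeGroup.mk_toWord, hg0, add_zero] at h1
  have h2 : E h y.1 + E h x.1 ≤ 0 := by
    have hxy := (isCyclicallyReduced_iff_ne_inv'.1 hc).2 y hy x hx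
    obtain ⟨u, hu⟩ : ∃ u, g.toWord = u ++ [y] :=
      ⟨_, (List.dropLast_append_getLast? y hy).symm⟩
    obtain ⟨v, hv⟩ : ∃ v, g.toWord = x :: v := by
      cases hw : g.toWord with
      | nil => exact absurd hw hne
      | cons z v => exact ⟨v, by simp [hw] at hx; rw [hx]⟩
    have h3 : ht φ (FreeGroup.mk (u ++ [y])) = 0 := by rw [← hu, FreeGroup.mk_toWord, hg0]
    have h4 : ht φ (FreeGroup.mk [y]) = ht φ (letter y) := rfl
    rw [ht_mk_append] at h3
    have hs1 := hs
    rw [hu, strip_append] at hs1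
    rw [hv] at hs
    have h5 := hs1.2.start
    exact hE' y x h hs.start.1 hs.start.2 hs.2.start.1 hs.2.start.2 (by omega) (by omega) hxy
  rw [FreeGroup.norm.eq_def g]
  omega

/-! ### The descent -/

theorem movable_comp_transv {φ : F →* Multiplicative ℤ} (hq : 0 < ht φ b) (hp : 0 ≤ ht φ a)
    (h : Movable φ) : Movable (φ.comp transv.toMonoidHom) := by
  refine h.comp fun g h1 h2 h3 => ?_
  by_cases hg1 : g = 1
  · exact ⟨1, by simp [hg1]⟩
  have hg0 := ht_eq_zero_of_mem_commutator (φ.comp transv.toMonoidHom) h2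
  obtain ⟨k, hk⟩ := h3.strip h1.isCyclicallyReduced hg0
  have ea : ht (φ.comp transv.toMonoidHom) a = ht φ a + ht φ b := by simp [ht_comp]
  have eb : ht (φ.comp transv.toMonoidHom) b = ht φ b := by simp [ht_comp]
  rw [ea, eb, abs_of_nonneg (by omega), abs_of_nonneg hq.le] at hk
  generalize hψ : φ.comp transv.toMonoidHom = ψ at *
  obtain ⟨q, hq'⟩ : ∃ q, q = ht φ b := ⟨_, rfl⟩
  obtain ⟨p, hp'⟩ : ∃ p, p = ht φ a + ht φ b := ⟨_, rfl⟩
  rw [← hp', ← hq'] at hk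
  rw [← hp'] at ea
  rw [← hq'] at eb
  have ta : transv.toMonoidHom a = a * b := transv_a
  have tb : transv.toMonoidHom b = b := transv_b
  have key := norm_add_norm_gauge_le (φ := ψ) (n := p + q) (θ₁ := transv.toMonoidHom)
    (θ₂ := endo (b * a) b) (γ₁ := fun h => if p < h then b⁻¹ else 1)
    (γ₂ := fun h => if h < q then b else 1)
    (E := fun h i => if h = 0 ∨ h = p + q then (if i = 0 then 1 else -1) else 0) ?_ ?_
    h1.isCyclicallyReduced hg1 hg0 hk
  · have e : endo (b * a) b g = b * transv g * b⁻¹ := by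
      have : endo (b * a) b = (MulAut.conj b * transv).toMonoidHom :=
        hom_ext (by simp; group) (by simp)
      rw [this]
      simp
    rw [e] at key
    by_contra! hcon
    have c1 := hcon (if p < k then b⁻¹ else 1)⁻¹
    have c2 := hcon ((if k < q then b else 1)⁻¹ * b)
    rw [inv_inv] at c1
    have e2 : ∀ c : F, c⁻¹ * b * transv g * (c⁻¹ * b)⁻¹ = c⁻¹ * (b * transv g * b⁻¹) * c := by
      intro c
      group
    rw [e2] at c2
    change FreeGroup.norm (_ * transv g * _) + _ ≤ _ at key
    omega
  · intro i h
    have nab := FreeGroup.norm_mul_le a b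
    have nba := FreeGroup.norm_mul_le b a
    rw [norm_a, norm_b] at nab nba
    fin_cases i
    · change _ → _ → 0 ≤ h + ht ψ a → h + ht ψ a ≤ _ →
        (FreeGroup.norm ((if p < h then b⁻¹ else 1)⁻¹ * transv.toMonoidHom a *
            if p < h + ht ψ a then b⁻¹ else 1) +
          FreeGroup.norm ((if h < q then b else 1)⁻¹ * endo (b * a) b a *
            if h + ht ψ a < q then b else 1) : ℤ) ≤
          2 + (if h = 0 ∨ h = p + q then 1 else 0) +
            (if h + ht ψ a = 0 ∨ h + ht ψ a = p + q then 1 else 0)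
      rw [ea, ta, endo_a]
      intro i1 i2 i3 i4
      rw [if_neg (by omega : ¬ p < h), if_neg (by omega : ¬ h + p < q),
        inv_one, one_mul, mul_one]
      have c1 : (FreeGroup.norm (a * b * if p < h + p then b⁻¹ else 1) : ℤ) ≤
          1 + if h = 0 then 1 else 0 := by
        split_ifs
        · omega
        · rw [mul_inv_cancel_right, norm_a]
          norm_num
        · rw [mul_one]
          omega
        · omega
      have c2 : (FreeGroup.norm ((if h < q then b else 1)⁻¹ * (b * a)) : ℤ) ≤
          1 + if h = q then 1 else 0 := by
        split_ifs
        · omega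
        · rw [inv_mul_cancel_left, norm_a]
          norm_num
        · rw [inv_one, one_mul]
          omega
        · omega
      split_ifs at c1 c2 ⊢ <;> omega
    · change _ → _ → 0 ≤ h + ht ψ b → h + ht ψ b ≤ _ →
        (FreeGroup.norm ((if p < h then b⁻¹ else 1)⁻¹ * transv.toMonoidHom b *
            if p < h + ht ψ b then b⁻¹ else 1) +
          FreeGroup.norm ((if h < q then b else 1)⁻¹ * endo (b * a) b b *
            if h + ht ψ b < q then b else 1) : ℤ) ≤
          2 + (if h = 0 ∨ h = p + q then -1 else 0) +
            (if h + ht ψ b = 0 ∨ h + ht ψ b = p + q then -1 else 0)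
      rw [eb, tb, endo_b]
      intro i1 i2 i3 i4
      rw [if_neg (by omega : ¬ p < h), if_neg (by omega : ¬ h + q < q),
        inv_one, one_mul, mul_one]
      have c1 : (FreeGroup.norm (b * if p < h + q then b⁻¹ else 1) : ℤ) ≤
          1 + if h + q = p + q then -1 else 0 := by
        split_ifs
        · simp
        · simp
        · omega
        · simp [norm_b]
      have c2 : (FreeGroup.norm ((if h < q then b else 1)⁻¹ * b) : ℤ) ≤
          1 + if h = 0 then -1 else 0 := by
        split_ifs
        · simp
        · simp
        · omega
        · simp [norm_b]
      split_ifs at c1 c2 ⊢ <;> omega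
  · rintro ⟨i, c⟩ ⟨j, d⟩ h i1 i2 i3 i4 i5 i6 hne
    have hij : i = j → c = d := by
      rintro rfl
      by_contra hcd
      exact hne (Prod.ext rfl (by cases c <;> cases d <;> simp_all [inv']))
    have hl : ∀ c, ht ψ (letter (0, c)) = if c then p else -p := by
      rintro (_ | _)
      · rw [← a_inv_eq, ht_inv, ea]
        rfl
      · exact ea
    have hl' : ∀ c, ht ψ (letter (1, c)) = if c then q else -q := by
      rintro (_ | _)
      · rw [← b_inv_eq, ht_inv, eb]
        rfl
      · exact eb
    dsimp only
    by_cases hh : h = 0 ∨ h = p + q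
    · rw [if_pos hh, if_pos hh]
      fin_cases i <;> fin_cases j
      · obtain rfl := hij rfl
        change 0 ≤ h + ht ψ (letter (0, c)) at i3
        change h + ht ψ (letter (0, c)) ≤ _ at i4
        change 0 ≤ h - ht ψ (letter (0, c)) at i5
        change h - ht ψ (letter (0, c)) ≤ _ at i6
        rw [hl] at i3 i4 i5 i6
        split_ifs at i3 i4 i5 i6 <;> omega
      · simp
      · simp
      · obtain rfl := hij rfl
        change 0 ≤ h + ht ψ (letter (1, c)) at i3
        change h + ht ψ (letter (1, c)) ≤ _ at i4
        change 0 ≤ h - ht ψ (letter (1, c)) at i5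
        change h - ht ψ (letter (1, c)) ≤ _ at i6
        rw [hl'] at i3 i4 i5 i6
        split_ifs at i3 i4 i5 i6 <;> omega
    · rw [if_neg hh, if_neg hh]
      rfl

theorem strip_mem_H {φ : F →* Multiplicative ℤ} (ha : ht φ a = 0) (hb : ht φ b = 1) {h : ℤ}
    {w : List (Fin 2 × Bool)} (hw : Strip φ 1 h w) :
    (if h = 1 then 1 else b⁻¹) * FreeGroup.mk w *
      (if h + ht φ (FreeGroup.mk w) = 1 then 1 else b⁻¹)⁻¹ ∈ H := by
  have hlet : ∀ x h, 0 ≤ h → h ≤ 1 → 0 ≤ h + ht φ (letter x) → h + ht φ (letter x) ≤ 1 →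
      (if h = 1 then 1 else b⁻¹) * letter x * (if h + ht φ (letter x) = 1 then 1 else b⁻¹)⁻¹
        ∈ H := by
    have h1 : a ∈ H := Subgroup.subset_closure (by simp)
    have h2 : b⁻¹ * a * b ∈ H := Subgroup.subset_closure (by simp)
    have h3 : b⁻¹ * a⁻¹ * b ∈ H := by
      have := H.inv_mem h2
      simpa [mul_assoc] using this
    rintro ⟨i, c⟩ h i1 i2 i3 i4
    fin_cases i <;> cases c
    · change 0 ≤ h + ht φ a⁻¹ at i3
      change h + ht φ a⁻¹ ≤ 1 at i4
      change _ * a⁻¹ * (if h + ht φ a⁻¹ = 1 then _ else _)⁻¹ ∈ H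
      rw [ht_inv, ha] at *
      simp only [neg_zero, add_zero]
      split_ifs
      · simpa using h1
      · simpa using h3
    · change 0 ≤ h + ht φ a at i3
      change h + ht φ a ≤ 1 at i4
      change _ * a * (if h + ht φ a = 1 then _ else _)⁻¹ ∈ H
      rw [ha] at *
      simp only [add_zero]
      split_ifs
      · simpa using h1
      · simpa using h2
    · change 0 ≤ h + ht φ b⁻¹ at i3
      change h + ht φ b⁻¹ ≤ 1 at i4
      change _ * b⁻¹ * (if h + ht φ b⁻¹ = 1 then _ else _)⁻¹ ∈ H
      rw [ht_inv, hb] at *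
      rw [if_pos (by omega), if_neg (by omega)]
      simp [H.one_mem]
    · change 0 ≤ h + ht φ b at i3
      change h + ht φ b ≤ 1 at i4
      change _ * b * (if h + ht φ b = 1 then _ else _)⁻¹ ∈ H
      rw [hb] at *
      rw [if_neg (by omega), if_pos (by omega)]
      simp [H.one_mem]
  induction w generalizing h with
  | nil =>
    have e : (FreeGroup.mk [] : F) = 1 := rfl
    simp [e, H.one_mem]
  | cons x w ih =>
    have h1 := hlet x h hw.1.1 hw.1.2 hw.2.start.1 hw.2.start.2
    have h2 := H.mul_mem h1 (ih hw.2)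
    rw [ht_mk_cons, mk_cons, ← add_assoc]
    convert h2 using 1
    group

theorem movable_of_height {φ : F →* Multiplicative ℤ} (ha : ht φ a = 0) (hb : ht φ b = 1) :
    Movable φ := by
  intro g h1 h2 h3
  have hg0 := ht_eq_zero_of_mem_commutator φ h2
  obtain ⟨h, hs⟩ := h3.strip h1.isCyclicallyReduced hg0
  rw [ha, hb] at hs
  have h4 := strip_mem_H ha hb hs
  rw [FreeGroup.mk_toWord, hg0, add_zero] at h4
  split_ifs at h4
  · exact ⟨1, rfl, by simpa using h4⟩
  · have h5 : Subgroup.map ((swapAB * flipA * swapAB) * MulAut.conj b).toMonoidHom H ≤ H := by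
      rw [Subgroup.map_le_iff_le_comap, H, Subgroup.closure_le]
      rintro _ (rfl | rfl)
      · refine Subgroup.subset_closure ?_
        simp
      · refine Subgroup.subset_closure ?_
        simp [mul_assoc]
    refine ⟨swapAB * flipA * swapAB, ?_, ?_⟩
    · refine le_antisymm (norm_apply_le_of_letters ?_ ?_ g) (h1 _)
      · simp [norm_a]
      · simp [norm_b]
    · have h6 := h5 ⟨_, h4, rfl⟩
      have e : ((swapAB * flipA * swapAB) * MulAut.conj b).toMonoidHom (b⁻¹ * g * b⁻¹⁻¹) =
          (swapAB * flipA * swapAB) g := by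
        change (swapAB * flipA * swapAB) (b * (b⁻¹ * g * b⁻¹⁻¹) * b⁻¹) = _
        congr 1
        group
      rwa [e] at h6

theorem comp_comp_cancel {φ : F →* Multiplicative ℤ} {σ τ : MulAut F} (h : σ * τ = 1) :
    (φ.comp σ.toMonoidHom).comp τ.toMonoidHom = φ := by
  ext x
  change φ ((σ * τ) (FreeGroup.of x)) = _
  rw [h]
  rfl

/-- Elements of minimal length that are narrow with respect to a primitive homomorphism can be
moved into `H`. -/
theorem movable_of_isCoprime {φ : F →* Multiplicative ℤ} (h : IsCoprime (ht φ a) (ht φ b)) :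
    Movable φ := by
  have hflip : flipA * flipA = 1 := mulAut_ext (by simp) (by simp)
  have hswap : swapAB * swapAB = 1 := mulAut_ext (by simp) (by simp)
  have hinv : transv⁻¹ = MulAut.conj b * (flipA * transv * flipA) := by
    rw [inv_eq_iff_mul_eq_one]
    refine mulAut_ext ?_ ?_ <;> simp [mul_assoc]
  induction hN : (ht φ a).natAbs + (ht φ b).natAbs using Nat.strong_induction_on generalizing φ with
  | _ N ih =>
  wlog hb0 : 0 ≤ ht φ b generalizing φ
  · exact Movable.of_inv (this (by simpa using h.neg_neg) (by simpa using hN) (by simp; omega))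
  wlog ha0 : 0 ≤ ht φ a generalizing φ
  · rw [← comp_comp_cancel (φ := φ) hflip]
    refine (this (φ := φ.comp flipA.toMonoidHom) ?_ ?_ ?_ ?_).comp_flipA
    all_goals
      simp [ht_comp]
      try omega
    exact h.neg_left
  wlog hab : ht φ b ≤ ht φ a generalizing φ
  · rw [← comp_comp_cancel (φ := φ) hswap]
    refine (this (φ := φ.comp swapAB.toMonoidHom) ?_ ?_ ?_ ?_ ?_).comp_swapAB
    all_goals
      simp [ht_comp]
      try omega
    exact h.symm
  rcases hb0.eq_or_lt with hb1 | hb1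
  · rw [← hb1, isCoprime_zero_right, Int.isUnit_iff] at h
    rw [← comp_comp_cancel (φ := φ) hswap]
    refine Movable.comp_swapAB (movable_of_height ?_ ?_)
    all_goals
      simp [ht_comp]
      try omega
  · rw [← comp_comp_cancel (φ := φ) (inv_mul_cancel transv)]
    have ea : ht (φ.comp (transv⁻¹).toMonoidHom) a = ht φ a - ht φ b := by
      rw [hinv]
      simp [ht_comp, sub_eq_add_neg]
    have eb : ht (φ.comp (transv⁻¹).toMonoidHom) b = ht φ b := by
      rw [hinv]
      simp [ht_comp]
    refine movable_comp_transv (by omega) (by omega) (ih _ ?_ ?_ rfl)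
    · omega
    · rw [ea, eb]
      simpa using (IsCoprime.sub_mul_right_left_iff (z := 1)).2 h

/-! ### Exponent sums -/

/-- The homomorphism to the integers with prescribed values on the generators. -/
def slopes (p q : ℤ) : F →* Multiplicative ℤ :=
  FreeGroup.lift ![Multiplicative.ofAdd p, Multiplicative.ofAdd q]

@[simp] theorem ht_slopes_a (p q : ℤ) : ht (slopes p q) a = p := by simp [ht, slopes, a]

@[simp] theorem ht_slopes_b (p q : ℤ) : ht (slopes p q) b = q := by simp [ht, slopes, b]

theorem ht_eq_sum (φ : F →* Multiplicative ℤ) (w : List (Fin 2 × Bool)) :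
    ht φ (FreeGroup.mk w) = ht φ a * aSum w + ht φ b * bSum w := by
  induction w with
  | nil => simp [aSum, bSum]
  | cons x w ih =>
    have hx : ht φ (letter x) = ht φ a * aSum [x] + ht φ b * bSum [x] := by
      obtain ⟨i, c⟩ := x
      fin_cases i <;> cases c
      · change ht φ a⁻¹ = _
        simp [aSum, bSum]
      · change ht φ a = _
        simp [aSum, bSum]
      · change ht φ b⁻¹ = _
        simp [aSum, bSum]
      · change ht φ b = _
        simp [aSum, bSum]
    have ha : aSum (x :: w) = aSum [x] + aSum w := by simp [aSum]
    have hb : bSum (x :: w) = bSum [x] + bSum w := by simp [bSum]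
    rw [ht_mk_cons, ih, hx, ha, hb]
    ring

theorem isCoprime_iff_exists_ht_eq_one {φ : F →* Multiplicative ℤ} :
    IsCoprime (ht φ a) (ht φ b) ↔ ∃ g, ht φ g = 1 := by
  constructor
  · rintro ⟨u, v, huv⟩
    refine ⟨a ^ u * b ^ v, ?_⟩
    have hz : ∀ (g : F) (k : ℤ), ht φ (g ^ k) = k * ht φ g := by
      intro g k
      simp [ht]
    rw [ht_mul, hz, hz, huv]
  · rintro ⟨g, hg⟩
    rw [← FreeGroup.mk_toWord (x := g), ht_eq_sum] at hg
    exact ⟨aSum g.toWord, bSum g.toWord, by linarith⟩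

theorem isCoprime_comp {φ : F →* Multiplicative ℤ} (h : IsCoprime (ht φ a) (ht φ b))
    (α : MulAut F) :
    IsCoprime (ht (φ.comp α.toMonoidHom) a) (ht (φ.comp α.toMonoidHom) b) := by
  rw [isCoprime_iff_exists_ht_eq_one] at h ⊢
  obtain ⟨g, hg⟩ := h
  exact ⟨α⁻¹ g, by
    change ht φ (α (α⁻¹ g)) = 1
    rwa [MulAut.apply_inv_self]⟩

/-! ### Powers of the commutator -/

theorem StripEl.zpow {φ : F →* Multiplicative ℤ} {n h : ℤ} {g : F} (hg : StripEl φ n h g)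
    (h0 : ht φ g = 0) (k : ℤ) : StripEl φ n h (g ^ k) := by
  have hone : StripEl φ n h 1 := stripEl_one.2 hg.start
  induction k with
  | zero => simpa using hone
  | succ k ih =>
    rw [zpow_add_one]
    refine ih.mul ?_
    have : ht φ (g ^ (k : ℤ)) = 0 := by simp [ht, show φ g = 1 from h0]
    rwa [this, add_zero]
  | pred k ih =>
    rw [zpow_sub_one]
    refine ih.mul ?_
    have : ht φ (g ^ (-k : ℤ)) = 0 := by simp [ht, show φ g = 1 from h0]
    rw [this, add_zero]
    exact hg.inv (by rw [h0, add_zero])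

theorem narrow_slopes_of_isConj_zpow {p q : ℤ} (hpq : p = 1 ∧ q = 0 ∨ p = 0 ∧ q = 1) {g : F}
    {k : ℤ} (hg : IsConj g (commAB ^ k)) : Narrow (slopes p q) g := by
  refine ⟨_, hg, 0, StripEl.zpow ?_ (by simp [commAB]) k⟩
  rw [ht_slopes_a, ht_slopes_b, commAB]
  refine StripEl.mul (StripEl.mul (StripEl.mul ?_ ?_) ?_) ?_
  · rw [stripEl_a]
    rcases hpq with ⟨rfl, rfl⟩ | ⟨rfl, rfl⟩ <;> simp
  · rw [stripEl_b]
    rcases hpq with ⟨rfl, rfl⟩ | ⟨rfl, rfl⟩ <;> simp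
  · rw [stripEl_a_inv]
    rcases hpq with ⟨rfl, rfl⟩ | ⟨rfl, rfl⟩ <;> simp
  · rw [stripEl_b_inv]
    rcases hpq with ⟨rfl, rfl⟩ | ⟨rfl, rfl⟩ <;> simp

/-- The path from the corner of the unit square to a given vertex. -/
def squarePath (i j : ℤ) : F := (if i = 0 then 1 else a) * (if j = 0 then 1 else b)

theorem squarePath_mem_zpowers {i j : ℤ} {w : List (Fin 2 × Bool)}
    (hi : Strip (slopes 1 0) 1 i w) (hj : Strip (slopes 0 1) 1 j w) :
    squarePath i j * FreeGroup.mk w * (squarePath (i + ht (slopes 1 0) (FreeGroup.mk w))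
      (j + ht (slopes 0 1) (FreeGroup.mk w)))⁻¹ ∈ Subgroup.zpowers commAB := by
  have hcomm : a * b * a⁻¹ * b⁻¹ ∈ Subgroup.zpowers commAB := Subgroup.mem_zpowers commAB
  have hcomm' : b * a * b⁻¹ * a⁻¹ ∈ Subgroup.zpowers commAB := by
    have := inv_mem hcomm
    simpa [mul_assoc] using this
  have hgen : ∀ k i j, 0 ≤ i → i ≤ 1 → 0 ≤ j → j ≤ 1 →
      0 ≤ i + ht (slopes 1 0) (letter (k, true)) → i + ht (slopes 1 0) (letter (k, true)) ≤ 1 →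
      0 ≤ j + ht (slopes 0 1) (letter (k, true)) → j + ht (slopes 0 1) (letter (k, true)) ≤ 1 →
      squarePath i j * letter (k, true) * (squarePath (i + ht (slopes 1 0) (letter (k, true)))
        (j + ht (slopes 0 1) (letter (k, true))))⁻¹ ∈ Subgroup.zpowers commAB := by
    intro k i j i1 i2 j1 j2
    fin_cases k
    · change 0 ≤ i + ht _ a → i + ht _ a ≤ 1 → 0 ≤ j + ht _ a → j + ht _ a ≤ 1 →
        _ * a * (squarePath (i + ht _ a) (j + ht _ a))⁻¹ ∈ _
      simp only [ht_slopes_a]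
      intro i3 i4 _ _
      obtain rfl : i = 0 := by omega
      obtain rfl | rfl : j = 0 ∨ j = 1 := by omega
      · simp [squarePath, one_mem]
      · simpa [squarePath, mul_assoc] using hcomm'
    · change 0 ≤ i + ht _ b → i + ht _ b ≤ 1 → 0 ≤ j + ht _ b → j + ht _ b ≤ 1 →
        _ * b * (squarePath (i + ht _ b) (j + ht _ b))⁻¹ ∈ _
      simp only [ht_slopes_b]
      intro _ _ j3 j4
      obtain rfl : j = 0 := by omega
      obtain rfl | rfl : i = 0 ∨ i = 1 := by omega
      · simp [squarePath, one_mem]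
      · simp [squarePath, one_mem]
  have hlet : ∀ x i j, 0 ≤ i → i ≤ 1 → 0 ≤ j → j ≤ 1 →
      0 ≤ i + ht (slopes 1 0) (letter x) → i + ht (slopes 1 0) (letter x) ≤ 1 →
      0 ≤ j + ht (slopes 0 1) (letter x) → j + ht (slopes 0 1) (letter x) ≤ 1 →
      squarePath i j * letter x * (squarePath (i + ht (slopes 1 0) (letter x))
        (j + ht (slopes 0 1) (letter x)))⁻¹ ∈ Subgroup.zpowers commAB := by
    rintro ⟨k, _ | _⟩ i j i1 i2 j1 j2 i3 i4 j3 j4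
    · have e : letter (k, false) = (letter (k, true))⁻¹ := letter_inv' (k, true)
      rw [e, ht_inv] at i3 i4 j3 j4
      have := inv_mem (hgen k _ _ i3 i4 j3 j4 (by omega) (by omega) (by omega) (by omega))
      rw [neg_add_cancel_right, neg_add_cancel_right] at this
      rw [e, ht_inv, ht_inv]
      simpa [mul_assoc] using this
    · exact hgen k i j i1 i2 j1 j2 i3 i4 j3 j4
  induction w generalizing i j with
  | nil =>
    have e : (FreeGroup.mk [] : F) = 1 := rfl
    simp [e, one_mem]
  | cons x w ih =>
    have h1 := hlet x i j hi.1.1 hi.1.2 hj.1.1 hj.1.2 hi.2.start.1 hi.2.start.2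
      hj.2.start.1 hj.2.start.2
    have h2 := mul_mem h1 (ih hi.2 hj.2)
    rw [ht_mk_cons, ht_mk_cons, mk_cons, ← add_assoc, ← add_assoc]
    convert h2 using 1
    group

theorem exists_isConj_zpow_of_strip {g : F} (hg : g ∈ commutator F) {i j : ℤ}
    (hi : Strip (slopes 1 0) 1 i g.toWord) (hj : Strip (slopes 0 1) 1 j g.toWord) :
    ∃ k : ℤ, IsConj g (commAB ^ k) := by
  obtain ⟨k, hk⟩ := squarePath_mem_zpowers hi hj
  rw [FreeGroup.mk_toWord, ht_eq_zero_of_mem_commutator _ hg, ht_eq_zero_of_mem_commutator _ hg,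
    add_zero, add_zero] at hk
  exact ⟨k, isConj_iff.2 ⟨_, hk.symm⟩⟩

/-! ### The extremal edges of the trace -/

/-- A cyclically reduced closed path runs along an edge at its maximal height. -/
theorem exists_edge_at_max {ψ : F →* Multiplicative ℤ} {i j : Fin 2} (hij : i ≠ j)
    (hi : ht ψ (letter (i, true)) = 0) (hj : ht ψ (letter (j, true)) ≠ 0) {g : F}
    (hg : IsCyclicallyReduced g) (hg1 : g ≠ 1) (hgc : g ∈ commutator F) :
    ∃ u u', u <+: g.toWord ∧ u' <+: g.toWord ∧
      (∀ φ, ht φ (FreeGroup.mk u') = ht φ (FreeGroup.mk u) + ht φ (letter (i, true))) ∧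
      ∀ v, v <+: g.toWord → ht ψ (FreeGroup.mk v) ≤ ht ψ (FreeGroup.mk u) := by
  have h0 : ∀ φ, ht φ (FreeGroup.mk g.toWord) = 0 := fun φ => by
    rw [FreeGroup.mk_toWord, ht_eq_zero_of_mem_commutator φ hgc]
  have hne : g.toWord ≠ [] := by simpa using hg1
  obtain ⟨u, hu, hmax⟩ : ∃ u, u <+: g.toWord ∧
      ∀ v, v <+: g.toWord → ht ψ (FreeGroup.mk v) ≤ ht ψ (FreeGroup.mk u) := by
    obtain ⟨u, hu, hm⟩ := Finset.exists_max_image g.toWord.inits.toFinset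
      (fun u => ht ψ (FreeGroup.mk u)) ⟨[], by simp⟩
    exact ⟨u, by simpa using hu, fun v hv => hm v (by simpa using hv)⟩
  obtain ⟨x, u₁, hu₁, hx, hxv⟩ : ∃ x u₁, u₁ <+: g.toWord ∧
      (∀ φ, ht φ (FreeGroup.mk u₁) = ht φ (FreeGroup.mk u) + ht φ (letter x)) ∧
      ∃ v t, g.toWord = u ++ v ∧ v ++ u = x :: t := by
    obtain ⟨v, hv⟩ := hu
    cases v with
    | nil =>
      rw [List.append_nil] at hv
      subst hv
      cases hw : g.toWord with
      | nil => exact absurd hw hne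
      | cons x t =>
        refine ⟨x, [x], by simp, fun φ => ?_, [], t, by simp, by simp⟩
        have := h0 φ
        rw [hw] at this
        rw [this, ht_mk_cons]
        simp
    | cons x t =>
      exact ⟨x, u ++ [x], ⟨t, by simp [hv]⟩, fun φ => by simp, x :: t, t ++ u, hv.symm, rfl⟩
  obtain ⟨y, u₂, hu₂, hy, hyv⟩ : ∃ y u₂, u₂ <+: g.toWord ∧
      (∀ φ, ht φ (FreeGroup.mk u) = ht φ (FreeGroup.mk u₂) + ht φ (letter y)) ∧
      ∃ v t, g.toWord = u ++ v ∧ v ++ u = t ++ [y] := by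
    obtain ⟨v, hv⟩ := hu
    rcases u.eq_nil_or_concat with rfl | ⟨t, y, rfl⟩
    · rw [List.nil_append] at hv
      subst hv
      rcases g.toWord.eq_nil_or_concat with hw | ⟨t, y, hw⟩
      · exact absurd hw hne
      · rw [List.concat_eq_append] at hw
        refine ⟨y, t, ⟨[y], hw.symm⟩, fun φ => ?_, t ++ [y], t, by simp [hw], by simp⟩
        have := h0 φ
        rw [hw, ht_mk_append, ht_mk_cons] at this
        simp only [ht_mk_nil] at this ⊢
        omega
    · rw [List.concat_eq_append] at hv ⊢
      exact ⟨y, t, ⟨y :: v, by simp [← hv]⟩, fun φ => by simp, v, v ++ t, hv.symm, by simp⟩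
  have hyx : x ≠ inv' y := by
    obtain ⟨v, t, hv, h1⟩ := hxv
    obtain ⟨v', t', hv', h2⟩ := hyv
    have hvv : v = v' := List.append_cancel_left (hv.symm.trans hv')
    subst hvv
    have hc := isCyclicallyReduced_toWord hg
    rw [hv] at hc
    have hc := (isCyclicallyReduced_iff_ne_inv'.1 (isCyclicallyReduced_rotate hc)).2
    exact hc y (by simp [h2]) x (by simp [h1])
  have hcase : ∀ x : Fin 2 × Bool, x.1 = i ∨ x.1 = j := by
    intro x
    have := x.1.2
    have := i.2
    have := j.2
    simp only [ne_eq, Fin.ext_iff] at hij ⊢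
    omega
  have hneg : ∀ φ, ht φ (letter (i, false)) = -ht φ (letter (i, true)) :=
    fun φ => ht_inv' φ (i, true)
  have hnegj : ∀ φ, ht φ (letter (j, false)) = -ht φ (letter (j, true)) :=
    fun φ => ht_inv' φ (j, true)
  have hm1 := hmax _ hu₁
  have hm2 := hmax _ hu₂
  rw [hx] at hm1
  have hy' := hy ψ
  rcases hcase x with h1 | h1
  · obtain ⟨k, c⟩ := x
    obtain rfl : k = i := h1
    cases c
    · refine ⟨u₁, u, hu₁, hu, fun φ => by rw [hx, hneg]; ring, fun v hv => ?_⟩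
      rw [hx, hneg, hi]
      simpa using hmax v hv
    · exact ⟨u, u₁, hu, hu₁, hx, hmax⟩
  rcases hcase y with h2 | h2
  · obtain ⟨k, c⟩ := y
    obtain rfl : k = i := h2
    cases c
    · exact ⟨u, u₂, hu, hu₂, fun φ => by rw [hy φ, hneg]; ring, hmax⟩
    · refine ⟨u₂, u, hu₂, hu, hy, fun v hv => ?_⟩
      rw [hi] at hy'
      have := hmax v hv
      omega
  · exfalso
    obtain ⟨k, c⟩ := x
    obtain rfl : k = j := h1
    obtain ⟨l, d⟩ := y
    obtain rfl : l = k := h2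
    cases c <;> cases d <;> simp only [hnegj, inv', ne_eq, Bool.not_true, Bool.not_false,
      not_true_eq_false] at * <;> omega

/-! ### Planar geometry -/

theorem mem_of_unique_min {S : Set (ℝ × ℝ)} {α β : ℝ} {v : ℝ × ℝ} (hv : v ∈ convexHull ℝ S)
    (h : ∀ s ∈ convexHull ℝ S, s ≠ v → α * v.1 + β * v.2 < α * s.1 + β * s.2) : v ∈ S := by
  by_contra hvS
  have hconv : Convex ℝ {s : ℝ × ℝ | α * v.1 + β * v.2 < α * s.1 + β * s.2} := by
    refine convex_halfSpace_gt (f := fun s : ℝ × ℝ => α * s.1 + β * s.2) ⟨?_, ?_⟩ _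
    · intro s t
      simp only [Prod.fst_add, Prod.snd_add]
      ring
    · intro c s
      simp only [Prod.smul_fst, Prod.smul_snd, smul_eq_mul]
      ring
  have := convexHull_min (fun s hs => h s (subset_convexHull ℝ S hs)
    (fun e => hvS (e ▸ hs))) hconv hv
  exact lt_irrefl (α * v.1 + β * v.2) this

theorem mem_segment_add_unitSquare {x y s : ℝ × ℝ} :
    s ∈ segment ℝ x y + unitSquare ↔ ∃ μ ∈ Set.Icc (0 : ℝ) 1,
      (x.1 + μ * (y.1 - x.1) ≤ s.1 ∧ s.1 ≤ x.1 + μ * (y.1 - x.1) + 1) ∧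
      x.2 + μ * (y.2 - x.2) ≤ s.2 ∧ s.2 ≤ x.2 + μ * (y.2 - x.2) + 1 := by
  rw [segment_eq_image']
  constructor
  · rintro ⟨_, ⟨μ, hμ, rfl⟩, e, ⟨⟨h1, h2⟩, h3, h4⟩, rfl⟩
    refine ⟨μ, hμ, ?_⟩
    simp only [Prod.fst_add, Prod.snd_add, Prod.smul_fst, Prod.smul_snd, smul_eq_mul,
      Prod.fst_sub, Prod.snd_sub]
    refine ⟨⟨?_, ?_⟩, ?_, ?_⟩ <;> linarith
  · rintro ⟨μ, hμ, ⟨h1, h2⟩, h3, h4⟩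
    refine ⟨_, ⟨μ, hμ, rfl⟩, s - (x + μ • (y - x)), ⟨⟨?_, ?_⟩, ?_, ?_⟩, by simp⟩ <;>
    · simp only [Prod.fst_add, Prod.snd_add, Prod.smul_fst, Prod.smul_snd, smul_eq_mul,
        Prod.fst_sub, Prod.snd_sub]
      linarith

/-- All points of the set have integral coordinates. -/
def Integral (S : Set (ℝ × ℝ)) : Prop := ∀ s ∈ S, ∃ m n : ℤ, s = ((m : ℝ), (n : ℝ))

theorem exists_int_direction {S : Set (ℝ × ℝ)} (hS : Integral S) {x y : ℝ × ℝ}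
    (h : convexHull ℝ S = segment ℝ x y + unitSquare) (h1 : 0 < y.1 - x.1) (h2 : y.2 - x.2 ≠ 0) :
    ∃ m n : ℤ, y.1 - x.1 = m ∧ y.2 - x.2 = n := by
  have key : ∀ u v : ℝ × ℝ, u ∈ S → v ∈ S → v.1 - u.1 - (y.1 - x.1) ∈ Set.range ((↑) : ℤ → ℝ) →
      v.2 - u.2 - (y.2 - x.2) ∈ Set.range ((↑) : ℤ → ℝ) →
      ∃ m n : ℤ, y.1 - x.1 = m ∧ y.2 - x.2 = n := by
    rintro u v hu hv ⟨i, hi⟩ ⟨j, hj⟩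
    obtain ⟨m, n, rfl⟩ := hS u hu
    obtain ⟨m', n', rfl⟩ := hS v hv
    refine ⟨m' - m - i, n' - n - j, ?_, ?_⟩ <;> push_cast <;> simp only at hi hj <;> linarith
  rcases lt_or_gt_of_ne h2 with h2 | h2
  · refine key (x.1, x.2 + 1) (y.1 + 1, y.2) (mem_of_unique_min (α := 1) (β := -1) ?_ ?_)
      (mem_of_unique_min (α := -1) (β := 1) ?_ ?_) ⟨1, by simp⟩ ⟨-1, by simp⟩
    · rw [h, mem_segment_add_unitSquare]
      exact ⟨0, by simp, by simp⟩
    · intro s hs hne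
      rw [h, mem_segment_add_unitSquare] at hs
      obtain ⟨μ, ⟨m0, m1⟩, ⟨h3, h4⟩, h5, h6⟩ := hs
      by_contra! hle
      have : μ * (y.1 - x.1 - (y.2 - x.2)) ≤ 0 := by simp only at hle; linarith
      have hμ : μ = 0 := by nlinarith
      subst hμ
      simp only at hle
      exact hne (Prod.ext (by simp only; linarith) (by simp only; linarith))
    · rw [h, mem_segment_add_unitSquare]
      exact ⟨1, by simp, by simp⟩
    · intro s hs hne
      rw [h, mem_segment_add_unitSquare] at hs
      obtain ⟨μ, ⟨m0, m1⟩, ⟨h3, h4⟩, h5, h6⟩ := hs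
      by_contra! hle
      have : (1 - μ) * (y.1 - x.1 - (y.2 - x.2)) ≤ 0 := by simp only at hle; linarith
      have hμ : μ = 1 := by nlinarith
      subst hμ
      simp only at hle
      exact hne (Prod.ext (by simp only; linarith) (by simp only; linarith))
  · refine key (x.1, x.2) (y.1 + 1, y.2 + 1) (mem_of_unique_min (α := 1) (β := 1) ?_ ?_)
      (mem_of_unique_min (α := -1) (β := -1) ?_ ?_) ⟨1, by simp⟩ ⟨1, by simp⟩
    · rw [h, mem_segment_add_unitSquare]
      exact ⟨0, by simp, by simp⟩
    · intro s hs hne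
      rw [h, mem_segment_add_unitSquare] at hs
      obtain ⟨μ, ⟨m0, m1⟩, ⟨h3, h4⟩, h5, h6⟩ := hs
      by_contra! hle
      have : μ * (y.1 - x.1 + (y.2 - x.2)) ≤ 0 := by simp only at hle; linarith
      have hμ : μ = 0 := by nlinarith
      subst hμ
      simp only at hle
      exact hne (Prod.ext (by simp only; linarith) (by simp only; linarith))
    · rw [h, mem_segment_add_unitSquare]
      exact ⟨1, by simp, by simp⟩
    · intro s hs hne
      rw [h, mem_segment_add_unitSquare] at hs
      obtain ⟨μ, ⟨m0, m1⟩, ⟨h3, h4⟩, h5, h6⟩ := hs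
      by_contra! hle
      have : (1 - μ) * (y.1 - x.1 + (y.2 - x.2)) ≤ 0 := by simp only at hle; linarith
      have hμ : μ = 1 := by nlinarith
      subst hμ
      simp only at hle
      exact hne (Prod.ext (by simp only; linarith) (by simp only; linarith))

theorem exists_isCoprime_orthogonal {S : Set (ℝ × ℝ)} (hS : Integral S) {x y : ℝ × ℝ}
    (h : convexHull ℝ S = segment ℝ x y + unitSquare) :
    ∃ p q : ℤ, IsCoprime p q ∧ p * (y.1 - x.1) + q * (y.2 - x.2) = 0 := by
  by_cases h1 : y.1 - x.1 = 0
  · exact ⟨1, 0, isCoprime_one_left, by simp [h1]⟩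
  by_cases h2 : y.2 - x.2 = 0
  · exact ⟨0, 1, isCoprime_one_right, by simp [h2]⟩
  obtain ⟨m, n, hm, hn⟩ : ∃ m n : ℤ, y.1 - x.1 = m ∧ y.2 - x.2 = n := by
    rcases lt_or_gt_of_ne h1 with h1 | h1
    · rw [segment_symm] at h
      obtain ⟨m, n, hm, hn⟩ := exists_int_direction hS h (by linarith)
        (fun e => h2 (by linarith))
      exact ⟨-m, -n, by push_cast; linarith, by push_cast; linarith⟩
    · exact exists_int_direction hS h h1 h2
  have hm0 : m ≠ 0 := by
    rintro rfl
    exact h1 (by simpa using hm)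
  have hg : 0 < Int.gcd m n := Int.gcd_pos_of_ne_zero_left _ hm0
  obtain ⟨m', n', hco, hm', hn'⟩ := Int.exists_gcd_one hg
  refine ⟨n', -m', (Int.isCoprime_iff_gcd_eq_one.2 hco).symm.neg_right, ?_⟩
  have hm' : (m : ℝ) = m' * (Int.gcd m n : ℤ) := by exact_mod_cast hm'
  have hn' : (n : ℝ) = n' * (Int.gcd m n : ℤ) := by exact_mod_cast hn'
  rw [hm, hn, hm', hn']
  push_cast
  ring

theorem exists_strip_of_convexHull_eq {S : Set (ℝ × ℝ)} (hS : Integral S) {x y : ℝ × ℝ}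
    (h : convexHull ℝ S = segment ℝ x y + unitSquare) :
    ∃ p q : ℤ, IsCoprime p q ∧ ∃ k : ℤ, ∀ m n : ℤ, ((m : ℝ), (n : ℝ)) ∈ S →
      0 ≤ k + (p * m + q * n) ∧ k + (p * m + q * n) ≤ |p| + |q| := by
  obtain ⟨p, q, hpq, ho⟩ := exists_isCoprime_orthogonal hS h
  refine ⟨p, q, hpq, -⌈p * x.1 + q * x.2 + min (p : ℝ) 0 + min (q : ℝ) 0⌉, fun m n hs => ?_⟩
  have hs := subset_convexHull ℝ S hs
  rw [h, mem_segment_add_unitSquare] at hs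
  obtain ⟨μ, -, ⟨h3, h4⟩, h5, h6⟩ := hs
  simp only at h3 h4 h5 h6
  have aux : ∀ r e : ℝ, 0 ≤ e → e ≤ 1 → min r 0 ≤ r * e ∧ r * e ≤ min r 0 + |r| := by
    intro r e e0 e1
    rcases le_total 0 r with hr | hr
    · rw [min_eq_right hr, abs_of_nonneg hr]
      constructor <;> nlinarith
    · rw [min_eq_left hr, abs_of_nonpos hr]
      constructor <;> nlinarith
  have a1 := aux p (m - (x.1 + μ * (y.1 - x.1))) (by linarith) (by linarith)
  have a2 := aux q (n - (x.2 + μ * (y.2 - x.2))) (by linarith) (by linarith)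
  have e : (p * m + q * n : ℝ) = p * x.1 + q * x.2 + p * (m - (x.1 + μ * (y.1 - x.1)))
      + q * (n - (x.2 + μ * (y.2 - x.2))) := by
    linear_combination μ * ho
  constructor
  · have : ⌈p * x.1 + q * x.2 + min (p : ℝ) 0 + min (q : ℝ) 0⌉ ≤ p * m + q * n := by
      rw [Int.ceil_le]
      push_cast
      linarith
    linarith
  · have h7 := Int.le_ceil (p * x.1 + q * x.2 + min (p : ℝ) 0 + min (q : ℝ) 0)
    have : ((p * m + q * n : ℤ) : ℝ) ≤
        ((⌈p * x.1 + q * x.2 + min (p : ℝ) 0 + min (q : ℝ) 0⌉ + |p| + |q| : ℤ) : ℝ) := by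
      push_cast
      linarith
    have := Int.cast_le.1 this
    linarith

theorem eq_of_subset_square {S : Set (ℝ × ℝ)} {x y : ℝ × ℝ}
    (h : convexHull ℝ S = segment ℝ x y + unitSquare) {i j : ℝ}
    (hS : S ⊆ Set.Icc i (i + 1) ×ˢ Set.Icc j (j + 1)) : x = y := by
  have hC : convexHull ℝ S ⊆ Set.Icc i (i + 1) ×ˢ Set.Icc j (j + 1) :=
    convexHull_min hS ((convex_Icc _ _).prod (convex_Icc _ _))
  rw [h] at hC
  obtain ⟨⟨a1, -⟩, a3, -⟩ := @hC x (mem_segment_add_unitSquare.2 ⟨0, by simp, by simp⟩)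
  obtain ⟨⟨-, b2⟩, -, b4⟩ := @hC (x.1 + 1, x.2 + 1)
    (mem_segment_add_unitSquare.2 ⟨0, by simp, by simp⟩)
  obtain ⟨⟨c1, -⟩, c3, -⟩ := @hC y (mem_segment_add_unitSquare.2 ⟨1, by simp, by simp⟩)
  obtain ⟨⟨-, d2⟩, -, d4⟩ := @hC (y.1 + 1, y.2 + 1)
    (mem_segment_add_unitSquare.2 ⟨1, by simp, by simp⟩)
  simp only at b2 b4 d2 d4
  exact Prod.ext (by linarith) (by linarith)

theorem combination_mem {C : Set (ℝ × ℝ)} (hC : Convex ℝ C) {u v w : ℝ × ℝ} (hu : u ∈ C)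
    (hv : v ∈ C) (hw : w ∈ C) {α β γ z₁ z₂ : ℝ} (hα : 0 ≤ α) (hβ : 0 ≤ β) (hγ : 0 ≤ γ)
    (h : α + β + γ = 1) (h₁ : z₁ = α * u.1 + β * v.1 + γ * w.1)
    (h₂ : z₂ = α * u.2 + β * v.2 + γ * w.2) : (z₁, z₂) ∈ C := by
  have := hC.sum_mem (t := Finset.univ) (w := ![α, β, γ]) (z := ![u, v, w])
    (fun i _ => by fin_cases i <;> simpa) (by simp [Fin.sum_univ_three, h])
    (fun i _ => by fin_cases i <;> simpa)
  convert this using 1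
  simp [Fin.sum_univ_three, Prod.ext_iff, h₁, h₂]

/-- The four corners of the unit square based at `x` belong to `C`. -/
def Corners (C : Set (ℝ × ℝ)) (x : ℝ × ℝ) : Prop :=
  (x.1, x.2) ∈ C ∧ (x.1 + 1, x.2) ∈ C ∧ (x.1, x.2 + 1) ∈ C ∧ (x.1 + 1, x.2 + 1) ∈ C

theorem Corners.mem {C : Set (ℝ × ℝ)} (hC : Convex ℝ C) {x : ℝ × ℝ} (h : Corners C x)
    {s : ℝ × ℝ} (h₁ : x.1 ≤ s.1 ∧ s.1 ≤ x.1 + 1) (h₂ : x.2 ≤ s.2 ∧ s.2 ≤ x.2 + 1) : s ∈ C := by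
  obtain ⟨c1, c2, c3, c4⟩ := h
  have e1 : (s.1, x.2) ∈ C := combination_mem hC c1 c2 c2 (α := 1 - (s.1 - x.1))
    (β := s.1 - x.1) (γ := 0) (by linarith) (by linarith) le_rfl (by ring) (by ring) (by ring)
  have e2 : (s.1, x.2 + 1) ∈ C := combination_mem hC c3 c4 c4 (α := 1 - (s.1 - x.1))
    (β := s.1 - x.1) (γ := 0) (by linarith) (by linarith) le_rfl (by ring) (by ring) (by ring)
  exact combination_mem hC e1 e2 e2 (α := 1 - (s.2 - x.2))
    (β := s.2 - x.2) (γ := 0) (by linarith) (by linarith) le_rfl (by ring) (by ring) (by ring)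

/-- A set squeezed between the extreme points of a band and the band itself. -/
def IsBand (S : Set (ℝ × ℝ)) : Prop :=
  ∃ x y : ℝ × ℝ, Corners (convexHull ℝ S) x ∧ Corners (convexHull ℝ S) y ∧
    S ⊆ segment ℝ x y + unitSquare

theorem IsBand.exists_convexHull_eq {S : Set (ℝ × ℝ)} (h : IsBand S) :
    ∃ x y : ℝ × ℝ, convexHull ℝ S = segment ℝ x y + unitSquare := by
  obtain ⟨x, y, hx, hy, hS⟩ := h
  refine ⟨x, y, (convexHull_min hS ((convex_segment x y).add
    ((convex_Icc _ _).prod (convex_Icc _ _)))).antisymm fun s hs => ?_⟩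
  obtain ⟨μ, ⟨m0, m1⟩, h1, h2⟩ := mem_segment_add_unitSquare.1 hs
  have hC := convex_convexHull ℝ S
  have e1 : (s.1 - μ * (y.1 - x.1), s.2 - μ * (y.2 - x.2)) ∈ convexHull ℝ S :=
    hx.mem hC ⟨by simp only; linarith, by simp only; linarith⟩
      ⟨by simp only; linarith, by simp only; linarith⟩
  have e2 : (s.1 + (1 - μ) * (y.1 - x.1), s.2 + (1 - μ) * (y.2 - x.2)) ∈ convexHull ℝ S :=
    hy.mem hC ⟨by simp only; linarith, by simp only; linarith⟩
      ⟨by simp only; linarith, by simp only; linarith⟩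
  exact combination_mem hC e1 e2 e2 (α := 1 - μ) (β := μ) (γ := 0) (by linarith) m0 le_rfl
    (by ring) (by simp only; ring) (by simp only; ring)

/-- An integral set inside a strip of minimal width that contains an edge on each side of its
bounding box. -/
structure Framed (S : Set (ℝ × ℝ)) (p q c : ℝ) : Prop where
  integral : Integral S
  left : ∃ s ∈ S, (s.1, s.2 + 1) ∈ S ∧ ∀ v ∈ S, s.1 ≤ v.1
  right : ∃ s ∈ S, (s.1, s.2 + 1) ∈ S ∧ ∀ v ∈ S, v.1 ≤ s.1
  bottom : ∃ s ∈ S, (s.1 + 1, s.2) ∈ S ∧ ∀ v ∈ S, s.2 ≤ v.2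
  top : ∃ s ∈ S, (s.1 + 1, s.2) ∈ S ∧ ∀ v ∈ S, v.2 ≤ s.2
  strip : ∀ s ∈ S, c ≤ p * s.1 + q * s.2 ∧ p * s.1 + q * s.2 ≤ c + |p| + |q|

theorem Integral.exists_sub {S : Set (ℝ × ℝ)} (hS : Integral S) {s t : ℝ × ℝ} (hs : s ∈ S)
    (ht : t ∈ S) : (∃ m : ℤ, s.1 - t.1 = m) ∧ ∃ n : ℤ, s.2 - t.2 = n := by
  obtain ⟨m, n, rfl⟩ := hS s hs
  obtain ⟨m', n', rfl⟩ := hS t ht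
  exact ⟨⟨m - m', by push_cast; rfl⟩, ⟨n - n', by push_cast; rfl⟩⟩

theorem Framed.neg {S : Set (ℝ × ℝ)} {p q c : ℝ} (h : Framed S p q c) :
    Framed S (-p) (-q) (-c - |p| - |q|) :=
  { h with
    strip := fun s hs => by
      rw [abs_neg, abs_neg]
      have := h.strip s hs
      constructor <;> linarith }

theorem Framed.isBand_of_pos {S : Set (ℝ × ℝ)} {p q c : ℝ} (h : Framed S p q c) (hp : 0 < p)
    (hq : 0 < q) : IsBand S := by
  obtain ⟨hS, ⟨l, l1, l2, l3⟩, ⟨r, r1, r2, r3⟩, ⟨y, y1, y2, y3⟩, ⟨t, t1, t2, t3⟩, hs⟩ := h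
  rw [abs_of_pos hp, abs_of_pos hq] at hs
  have i1 := hs _ l1
  have i2 := hs _ y1
  have i3 := hs _ t2
  have i4 := hs _ r2
  have i5 := l3 _ t1
  have i6 := t3 _ l2
  have i7 := r3 _ y2
  have i8 := y3 _ r1
  simp only at i1 i2 i3 i4 i5 i6 i7 i8
  have e1 : t.1 = l.1 := by nlinarith
  have e2 : t.2 = l.2 + 1 := by nlinarith
  have e3 : r.1 = y.1 + 1 := by nlinarith
  have e4 : r.2 = y.2 := by nlinarith
  obtain ⟨⟨m, hm⟩, -⟩ := hS.exists_sub y1 l1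
  obtain ⟨-, n, hn⟩ := hS.exists_sub l1 y1
  have e5 : p * m = q * n := by
    rw [← hm, ← hn]
    rw [e1, e2] at i3
    rw [e3, e4] at i4
    linarith
  have m0 : (0 : ℝ) ≤ m := by
    have := l3 _ y1
    linarith
  have n0 : (0 : ℝ) ≤ n := by
    have := y3 _ l1
    linarith
  have hsub := subset_convexHull ℝ S
  have c1 := hsub l1
  have c2 := hsub l2
  have c3 := hsub t2
  have d1 := hsub y1
  have d2 := hsub y2
  have d3 := hsub r2
  rw [e1, e2] at c3
  rw [e3, e4] at d3
  have hc := convex_convexHull ℝ S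
  rcases m0.eq_or_lt with m0 | m0
  · have n0 : (n : ℝ) = 0 := by nlinarith
    have e6 : y = l := Prod.ext (by linarith) (by linarith)
    subst e6
    have hcor : Corners (convexHull ℝ S) y := ⟨d1, d2, c2, d3⟩
    refine ⟨y, y, hcor, hcor, fun s hs' => mem_segment_add_unitSquare.2 ⟨0, by simp, ?_⟩⟩
    have := l3 s hs'
    have := r3 s hs'
    have := y3 s hs'
    have := t3 s hs'
    refine ⟨⟨?_, ?_⟩, ?_, ?_⟩ <;> linarith
  have n0 : (0 : ℝ) < n := by
    by_contra! hle
    nlinarith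
  have m1 : (1 : ℝ) ≤ m := by
    have : 0 < m := by exact_mod_cast m0
    exact_mod_cast this
  have hmn : (m + n : ℝ) ≠ 0 := by positivity
  refine ⟨l, y, ⟨c1, combination_mem hc c3 c1 d1 (α := n / (m + n)) (β := (m - 1) / (m + n))
    (γ := 1 / (m + n)) ?_ ?_ ?_ ?_ ?_ ?_, c2, c3⟩, ⟨d1, d2, combination_mem hc d1 d3 c3
    (α := n / (m + n)) (β := (m - 1) / (m + n)) (γ := 1 / (m + n)) ?_ ?_ ?_ ?_ ?_ ?_, d3⟩,
    fun s hs' => mem_segment_add_unitSquare.2 ?_⟩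
  · positivity
  · exact div_nonneg (by linarith) (by positivity)
  · positivity
  · field_simp
    ring
  · field_simp
    linarith
  · field_simp
    linarith
  · positivity
  · exact div_nonneg (by linarith) (by positivity)
  · positivity
  · field_simp
    ring
  · field_simp
    linarith
  · field_simp
    linarith
  have b1 := l3 s hs'
  have b2 := r3 s hs'
  have b3 := y3 s hs'
  have b4 := t3 s hs'
  obtain ⟨b5, b6⟩ := hs s hs'
  have f1 : 0 ≤ n * (s.1 - l.1) + m * (s.2 - l.2) := by
    have : 0 ≤ q * (n * (s.1 - l.1) + m * (s.2 - l.2)) := by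
      have e : q * (n * (s.1 - l.1) + m * (s.2 - l.2)) =
          m * (p * (s.1 - l.1) + q * (s.2 - l.2)) := by
        linear_combination -(s.1 - l.1) * e5
      rw [e]
      exact mul_nonneg m0.le (by nlinarith)
    exact nonneg_of_mul_nonneg_right this hq
  have f2 : n * (s.1 - l.1) + m * (s.2 - l.2) ≤ m + n := by
    have : 0 ≤ q * (m + n - (n * (s.1 - l.1) + m * (s.2 - l.2))) := by
      have e : q * (m + n - (n * (s.1 - l.1) + m * (s.2 - l.2))) =
          m * (p + q - (p * (s.1 - l.1) + q * (s.2 - l.2))) := by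
        linear_combination (s.1 - l.1 - 1) * e5
      rw [e]
      exact mul_nonneg m0.le (by linarith)
    linarith [nonneg_of_mul_nonneg_right this hq]
  set μ := max 0 (max ((s.1 - l.1 - 1) / m) (-(s.2 - l.2) / n)) with hμ
  have g0 : 0 ≤ μ := le_max_left _ _
  have g1 : (s.1 - l.1 - 1) / m ≤ μ := (le_max_left _ _).trans (le_max_right _ _)
  have g2 : -(s.2 - l.2) / n ≤ μ := (le_max_right _ _).trans (le_max_right _ _)
  have g3 : μ ≤ 1 := max_le zero_le_one (max_le ((div_le_one m0).2 (by linarith))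
    ((div_le_one n0).2 (by linarith)))
  have g4 : μ ≤ (s.1 - l.1) / m := max_le (div_nonneg (by linarith) m0.le)
    (max_le ((div_le_div_iff_of_pos_right m0).2 (by linarith))
      (by rw [div_le_div_iff₀ n0 m0]; linarith))
  have g5 : μ ≤ (1 - (s.2 - l.2)) / n := max_le (div_nonneg (by linarith) n0.le)
    (max_le (by rw [div_le_div_iff₀ m0 n0]; linarith)
      ((div_le_div_iff_of_pos_right n0).2 (by linarith)))
  rw [div_le_iff₀ m0] at g1
  rw [div_le_iff₀ n0] at g2
  rw [le_div_iff₀ m0] at g4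
  rw [le_div_iff₀ n0] at g5
  have e6 : y.2 - l.2 = -n := by linarith
  rw [hm, e6]
  refine ⟨μ, ⟨g0, g3⟩, ⟨?_, ?_⟩, ?_, ?_⟩ <;> linarith

theorem Framed.isBand_of_eq_zero {S : Set (ℝ × ℝ)} {p c : ℝ} (h : Framed S p 0 c) (hp : 0 < p) :
    IsBand S := by
  obtain ⟨hS, ⟨l, l1, l2, l3⟩, ⟨r, r1, r2, r3⟩, ⟨y, y1, y2, y3⟩, ⟨t, t1, t2, t3⟩, hs⟩ := h
  rw [abs_of_pos hp, abs_zero] at hs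
  have i1 := hs _ t1
  have i2 := hs _ t2
  have i3 := hs _ y1
  have i4 := hs _ y2
  have i5 := y3 _ l1
  have i6 := t3 _ l2
  simp only at i1 i2 i3 i4 i5 i6
  have i7 := hs _ l1
  have e1 : t.1 = y.1 := by nlinarith
  have hsub := subset_convexHull ℝ S
  have c1 := hsub y1
  have c2 := hsub y2
  have c3 := hsub t1
  have c4 := hsub t2
  have hc := convex_convexHull ℝ S
  have e2 : p * y.1 = c := by nlinarith
  set N := t.2 - 1 - y.2 with hN
  have hN0 : 0 ≤ N := by linarith
  have hN1 : N + 1 ≠ 0 := by positivity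
  refine ⟨y, (t.1, t.2 - 1), ⟨c1, c2, ?_, ?_⟩, ⟨?_, ?_, by simpa using c3, by simpa using c4⟩,
    fun s hs' => mem_segment_add_unitSquare.2 ?_⟩
  · refine combination_mem hc c1 c3 c3 (α := N / (N + 1)) (β := 1 / (N + 1)) (γ := 0)
      (by positivity) (by positivity) le_rfl (by field_simp; ring) ?_ ?_
    · rw [e1]
      field_simp
      ring
    · field_simp
      rw [hN]
      ring
  · refine combination_mem hc c2 c4 c4 (α := N / (N + 1)) (β := 1 / (N + 1)) (γ := 0)
      (by positivity) (by positivity) le_rfl (by field_simp; ring) ?_ ?_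
    · rw [e1]
      field_simp
      ring
    · field_simp
      rw [hN]
      ring
  · refine combination_mem hc c1 c3 c3 (α := 1 / (N + 1)) (β := N / (N + 1)) (γ := 0)
      (by positivity) (by positivity) le_rfl (by field_simp; ring) ?_ ?_
    · rw [e1]
      field_simp
      ring
    · field_simp
      rw [hN]
      ring
  · refine combination_mem hc c2 c4 c4 (α := 1 / (N + 1)) (β := N / (N + 1)) (γ := 0)
      (by positivity) (by positivity) le_rfl (by field_simp; ring) ?_ ?_
    · rw [e1]
      field_simp
      ring
    · field_simp
      rw [hN]
      ring
  have b3 := y3 s hs'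
  have b4 := t3 s hs'
  obtain ⟨b5, b6⟩ := hs s hs'
  have f1 : y.1 ≤ s.1 := by nlinarith
  have f2 : s.1 ≤ y.1 + 1 := by nlinarith
  simp only [e1, sub_self, mul_zero, add_zero]
  suffices ∃ μ ∈ Set.Icc (0 : ℝ) 1, μ * N ≤ s.2 - y.2 ∧ s.2 - y.2 ≤ μ * N + 1 by
    obtain ⟨μ, hμ, g1, g2⟩ := this
    refine ⟨μ, hμ, ⟨f1, f2⟩, ?_⟩
    rw [hN] at g1 g2
    constructor <;> linarith
  rcases hN0.eq_or_lt with h0 | h0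
  · exact ⟨0, by simp, by linarith, by linarith⟩
  · refine ⟨max 0 ((s.2 - y.2 - 1) / N), ⟨le_max_left _ _, max_le zero_le_one
      ((div_le_one h0).2 (by linarith))⟩, ?_, ?_⟩
    · rw [← le_div_iff₀ h0]
      exact max_le (div_nonneg (by linarith) hN0)
        ((div_le_div_iff_of_pos_right h0).2 (by linarith))
    · have := le_max_right 0 ((s.2 - y.2 - 1) / N)
      rw [div_le_iff₀ h0] at this
      linarith

theorem IsBand.of_swap {S : Set (ℝ × ℝ)} (h : IsBand {s | (s.2, s.1) ∈ S}) : IsBand S := by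
  obtain ⟨x, y, ⟨x1, x2, x3, x4⟩, ⟨y1, y2, y3, y4⟩, hS⟩ := h
  have key : ∀ u v : ℝ, (u, v) ∈ convexHull ℝ {s : ℝ × ℝ | (s.2, s.1) ∈ S} →
      (v, u) ∈ convexHull ℝ S := fun u v huv =>
    convexHull_min (t := {s : ℝ × ℝ | (s.2, s.1) ∈ convexHull ℝ S})
      (fun s hs => subset_convexHull ℝ S hs) ((convex_convexHull ℝ S).is_linear_preimage
        (f := fun s : ℝ × ℝ => (s.2, s.1)) ⟨fun _ _ => rfl, fun _ _ => rfl⟩) huv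
  refine ⟨(x.2, x.1), (y.2, y.1), ⟨key _ _ x1, key _ _ x3, key _ _ x2, key _ _ x4⟩,
    ⟨key _ _ y1, key _ _ y3, key _ _ y2, key _ _ y4⟩, fun s hs => ?_⟩
  have := @hS (s.2, s.1) hs
  rw [mem_segment_add_unitSquare] at this ⊢
  obtain ⟨μ, hμ, h1, h2⟩ := this
  exact ⟨μ, hμ, h2, h1⟩

theorem IsBand.of_reflect {S : Set (ℝ × ℝ)} (h : IsBand {s | (s.1, -s.2) ∈ S}) : IsBand S := by
  obtain ⟨x, y, ⟨x1, x2, x3, x4⟩, ⟨y1, y2, y3, y4⟩, hS⟩ := h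
  have key : ∀ u v w : ℝ, (u, v) ∈ convexHull ℝ {s : ℝ × ℝ | (s.1, -s.2) ∈ S} → w = -v →
      (u, w) ∈ convexHull ℝ S := fun u v w huv hw => hw ▸
    convexHull_min (t := {s : ℝ × ℝ | (s.1, -s.2) ∈ convexHull ℝ S})
      (fun s hs => subset_convexHull ℝ S hs) ((convex_convexHull ℝ S).is_linear_preimage
        (f := fun s : ℝ × ℝ => (s.1, -s.2)) ⟨fun _ _ => by simp [add_comm], fun _ _ => by simp⟩) huv
  refine ⟨(x.1, -(x.2 + 1)), (y.1, -(y.2 + 1)),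
    ⟨key _ _ _ x3 rfl, key _ _ _ x4 rfl, key _ _ _ x1 (by ring), key _ _ _ x2 (by ring)⟩,
    ⟨key _ _ _ y3 rfl, key _ _ _ y4 rfl, key _ _ _ y1 (by ring), key _ _ _ y2 (by ring)⟩,
    fun s hs => ?_⟩
  have := @hS (s.1, -s.2) (by simpa using hs)
  rw [mem_segment_add_unitSquare] at this ⊢
  obtain ⟨μ, hμ, h1, h2, h3⟩ := this
  simp only at h2 h3
  exact ⟨μ, hμ, h1, by simp only; linarith, by simp only; linarith⟩

theorem Framed.swap {S : Set (ℝ × ℝ)} {p q c : ℝ} (h : Framed S p q c) :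
    Framed {s | (s.2, s.1) ∈ S} q p c where
  integral s hs := by
    obtain ⟨m, n, e⟩ := h.integral _ hs
    simp only [Prod.mk.injEq] at e
    exact ⟨n, m, Prod.ext e.2 e.1⟩
  left := by
    obtain ⟨s, h1, h2, h3⟩ := h.bottom
    exact ⟨(s.2, s.1), h1, h2, fun v hv => h3 _ hv⟩
  right := by
    obtain ⟨s, h1, h2, h3⟩ := h.top
    exact ⟨(s.2, s.1), h1, h2, fun v hv => h3 _ hv⟩
  bottom := by
    obtain ⟨s, h1, h2, h3⟩ := h.left
    exact ⟨(s.2, s.1), h1, h2, fun v hv => h3 _ hv⟩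
  top := by
    obtain ⟨s, h1, h2, h3⟩ := h.right
    exact ⟨(s.2, s.1), h1, h2, fun v hv => h3 _ hv⟩
  strip s hs := by
    have := h.strip _ hs
    simp only at this
    constructor <;> linarith

theorem Framed.reflect {S : Set (ℝ × ℝ)} {p q c : ℝ} (h : Framed S p q c) :
    Framed {s | (s.1, -s.2) ∈ S} p (-q) c where
  integral s hs := by
    obtain ⟨m, n, e⟩ := h.integral _ hs
    simp only [Prod.mk.injEq] at e
    exact ⟨m, -n, Prod.ext e.1 (by push_cast; linarith)⟩
  left := by
    obtain ⟨s, h1, h2, h3⟩ := h.left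
    exact ⟨(s.1, -(s.2 + 1)), by simpa using h2, by simpa using h1,
      fun v hv => h3 (v.1, -v.2) hv⟩
  right := by
    obtain ⟨s, h1, h2, h3⟩ := h.right
    exact ⟨(s.1, -(s.2 + 1)), by simpa using h2, by simpa using h1,
      fun v hv => h3 (v.1, -v.2) hv⟩
  bottom := by
    obtain ⟨s, h1, h2, h3⟩ := h.top
    exact ⟨(s.1, -s.2), by simpa using h1, by simpa using h2,
      fun v hv => by have := h3 _ hv; simp only at this ⊢; linarith⟩
  top := by
    obtain ⟨s, h1, h2, h3⟩ := h.bottom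
    exact ⟨(s.1, -s.2), by simpa using h1, by simpa using h2,
      fun v hv => by have := h3 _ hv; simp only at this ⊢; linarith⟩
  strip s hs := by
    have := h.strip _ hs
    simp only [abs_neg] at this ⊢
    constructor <;> linarith

theorem Framed.isBand {S : Set (ℝ × ℝ)} {p q c : ℝ} (h : Framed S p q c)
    (hpq : p ≠ 0 ∨ q ≠ 0) : IsBand S := by
  have pos : ∀ {S : Set (ℝ × ℝ)} {p q c : ℝ}, Framed S p q c → 0 < p → IsBand S := by
    intro S p q c h hp
    rcases lt_trichotomy q 0 with hq | rfl | hq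
    · exact (h.reflect.isBand_of_pos hp (by linarith)).of_reflect
    · exact h.isBand_of_eq_zero hp
    · exact h.isBand_of_pos hp hq
  have ne : ∀ {S : Set (ℝ × ℝ)} {p q c : ℝ}, Framed S p q c → p ≠ 0 → IsBand S := by
    intro S p q c h hp
    rcases lt_or_gt_of_ne hp with hp | hp
    · exact pos h.neg (by linarith)
    · exact pos h hp
  rcases hpq with hp | hq
  · exact ne h hp
  · exact (ne h.swap hq).of_swap

/-! ### The equivalence -/

theorem mem_trace {R : F} {u : List (Fin 2 × Bool)} (hu : u <+: R.toWord) :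
    ((aSum u : ℝ), (bSum u : ℝ)) ∈ trace R := ⟨u, hu, rfl⟩

theorem integral_trace (R : F) : Integral (trace R) := by
  rintro _ ⟨u, -, rfl⟩
  exact ⟨aSum u, bSum u, rfl⟩

theorem ht_slopes_mk (p q : ℤ) (u : List (Fin 2 × Bool)) :
    ht (slopes p q) (FreeGroup.mk u) = p * aSum u + q * bSum u := by
  rw [ht_eq_sum, ht_slopes_a, ht_slopes_b]

theorem aSum_eq_ht (u : List (Fin 2 × Bool)) : aSum u = ht (slopes 1 0) (FreeGroup.mk u) := by
  simp [ht_slopes_mk]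

theorem bSum_eq_ht (u : List (Fin 2 × Bool)) : bSum u = ht (slopes 0 1) (FreeGroup.mk u) := by
  simp [ht_slopes_mk]

theorem stripEl_of_mem_H {g : F} (hg : g ∈ H) :
    StripEl (slopes 0 1) 1 1 g ∧ ht (slopes 0 1) g = 0 := by
  induction hg using Subgroup.closure_induction with
  | mem x hx =>
    rcases hx with rfl | rfl
    · exact ⟨by simp [stripEl_a], by simp⟩
    · refine ⟨StripEl.mul (StripEl.mul ?_ ?_) ?_, by simp⟩
      · simp [stripEl_b_inv]
      · simp [stripEl_a]
      · simp [stripEl_b]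
  | one => exact ⟨by simp [stripEl_one], by simp⟩
  | mul x y _ _ hx hy => exact ⟨hx.1.mul (by simpa [hx.2] using hy.1), by simp [hx.2, hy.2]⟩
  | inv x _ hx => exact ⟨hx.1.inv (by simp [hx.2]), by simp [hx.2]⟩

theorem exists_orbitMin (R : F) : ∃ α : MulAut F, OrbitMin (α R) ∧
    ∀ β : MulAut F, FreeGroup.norm (α R) ≤ FreeGroup.norm (β R) := by
  refine ⟨Function.argmin (fun α : MulAut F => FreeGroup.norm (α R)), fun β => ?_,
    fun β => Function.argmin_le (fun α : MulAut F => FreeGroup.norm (α R)) β⟩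
  exact Function.argmin_le (fun α : MulAut F => FreeGroup.norm (α R))
    (β * Function.argmin (fun α : MulAut F => FreeGroup.norm (α R)))

variable {R : F}

theorem subset_square_of_isConj_zpow (hRc : R ∈ commutator F) (hcr : IsCyclicallyReduced R)
    {k : ℤ} (hk : IsConj R (commAB ^ k)) :
    ∃ i j : ℝ, trace R ⊆ Set.Icc i (i + 1) ×ˢ Set.Icc j (j + 1) := by
  obtain ⟨h, hh⟩ := (narrow_slopes_of_isConj_zpow (.inl ⟨rfl, rfl⟩) hk).strip hcr
    (ht_eq_zero_of_mem_commutator _ hRc)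
  obtain ⟨h', hh'⟩ := (narrow_slopes_of_isConj_zpow (.inr ⟨rfl, rfl⟩) hk).strip hcr
    (ht_eq_zero_of_mem_commutator _ hRc)
  rw [strip_iff] at hh hh'
  refine ⟨-h, -h', ?_⟩
  rintro _ ⟨u, hu, rfl⟩
  have h1 := hh u hu
  have h2 := hh' u hu
  simp only [ht_slopes_mk, ht_slopes_a, ht_slopes_b, abs_one, abs_zero, one_mul, zero_mul,
    add_zero, zero_add] at h1 h2
  obtain ⟨h1, h3⟩ := h1
  obtain ⟨h2, h4⟩ := h2
  have h1 : (0 : ℝ) ≤ h + aSum u := by exact_mod_cast h1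
  have h2 : (0 : ℝ) ≤ h' + bSum u := by exact_mod_cast h2
  have h3 : (h + aSum u : ℝ) ≤ 1 := by exact_mod_cast h3
  have h4 : (h' + bSum u : ℝ) ≤ 1 := by exact_mod_cast h4
  refine ⟨⟨?_, ?_⟩, ?_, ?_⟩ <;> simp only <;> linarith

theorem exists_isConj_zpow_of_subset_square (hRc : R ∈ commutator F) {i j : ℝ}
    (h : trace R ⊆ Set.Icc i (i + 1) ×ˢ Set.Icc j (j + 1)) : ∃ k : ℤ, IsConj R (commAB ^ k) := by
  have aux : ∀ (c : ℝ) (m : ℤ), c ≤ m → (m : ℝ) ≤ c + 1 → 0 ≤ -⌈c⌉ + m ∧ -⌈c⌉ + m ≤ 1 := by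
    intro c m h1 h2
    have h3 := Int.ceil_le.2 h1
    have h4 : (m : ℝ) ≤ (⌈c⌉ + 1 : ℤ) := by
      push_cast
      linarith [Int.le_ceil c]
    have h4 := Int.cast_le.1 h4
    constructor <;> omega
  refine exists_isConj_zpow_of_strip hRc (i := -⌈i⌉) (j := -⌈j⌉) ?_ ?_
  · refine strip_iff.2 fun u hu => ?_
    rw [← aSum_eq_ht]
    have := (h (mem_trace hu)).1
    exact aux _ _ this.1 this.2
  · refine strip_iff.2 fun u hu => ?_
    rw [← bSum_eq_ht]
    have := (h (mem_trace hu)).2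
    exact aux _ _ this.1 this.2

theorem exists_vertical_edge (hR1 : R ≠ 1) (hRc : R ∈ commutator F) (hcr : IsCyclicallyReduced R)
    {p : ℤ} (hp : p ≠ 0) :
    ∃ s ∈ trace R, (s.1, s.2 + 1) ∈ trace R ∧ ∀ v ∈ trace R, p * v.1 ≤ p * s.1 := by
  obtain ⟨u, u', hu, hu', h1, h2⟩ := exists_edge_at_max (ψ := slopes p 0) (i := 1) (j := 0)
    (by decide) (ht_slopes_b _ _) (by rwa [show letter (0, true) = a from rfl, ht_slopes_a])
    hcr hR1 hRc
  have e1 : aSum u' = aSum u := by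
    rw [aSum_eq_ht, aSum_eq_ht, h1, show letter (1, true) = b from rfl, ht_slopes_b, add_zero]
  have e2 : bSum u' = bSum u + 1 := by
    rw [bSum_eq_ht, bSum_eq_ht, h1, show letter (1, true) = b from rfl, ht_slopes_b]
  refine ⟨_, mem_trace hu, ?_, ?_⟩
  · have := mem_trace hu'
    rw [e1, e2] at this
    push_cast at this
    exact this
  · rintro _ ⟨v, hv, rfl⟩
    have := h2 v hv
    rw [ht_slopes_mk, ht_slopes_mk, zero_mul, zero_mul, add_zero, add_zero] at this
    simp only
    exact_mod_cast this

theorem exists_horizontal_edge (hR1 : R ≠ 1) (hRc : R ∈ commutator F)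
    (hcr : IsCyclicallyReduced R) {q : ℤ} (hq : q ≠ 0) :
    ∃ s ∈ trace R, (s.1 + 1, s.2) ∈ trace R ∧ ∀ v ∈ trace R, q * v.2 ≤ q * s.2 := by
  obtain ⟨u, u', hu, hu', h1, h2⟩ := exists_edge_at_max (ψ := slopes 0 q) (i := 0) (j := 1)
    (by decide) (ht_slopes_a _ _) (by rwa [show letter (1, true) = b from rfl, ht_slopes_b])
    hcr hR1 hRc
  have e1 : aSum u' = aSum u + 1 := by
    rw [aSum_eq_ht, aSum_eq_ht, h1, show letter (0, true) = a from rfl, ht_slopes_a]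
  have e2 : bSum u' = bSum u := by
    rw [bSum_eq_ht, bSum_eq_ht, h1, show letter (0, true) = a from rfl, ht_slopes_a, add_zero]
  refine ⟨_, mem_trace hu, ?_, ?_⟩
  · have := mem_trace hu'
    rw [e1, e2] at this
    push_cast at this
    exact this
  · rintro _ ⟨v, hv, rfl⟩
    have := h2 v hv
    rw [ht_slopes_mk, ht_slopes_mk, zero_mul, zero_mul, zero_add, zero_add] at this
    simp only
    exact_mod_cast this

theorem framed_trace (hR1 : R ≠ 1) (hRc : R ∈ commutator F) (hcr : IsCyclicallyReduced R)
    {p q h : ℤ} (hs : Strip (slopes p q) (|p| + |q|) h R.toWord) : Framed (trace R) p q (-h) where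
  integral := integral_trace R
  left := by
    simpa using exists_vertical_edge hR1 hRc hcr (p := -1) (by decide)
  right := by
    simpa using exists_vertical_edge hR1 hRc hcr (p := 1) (by decide)
  bottom := by
    simpa using exists_horizontal_edge hR1 hRc hcr (q := -1) (by decide)
  top := by
    simpa using exists_horizontal_edge hR1 hRc hcr (q := 1) (by decide)
  strip := by
    rintro _ ⟨u, hu, rfl⟩
    obtain ⟨h1, h2⟩ := strip_iff.1 hs u hu
    rw [ht_slopes_mk] at h1 h2
    have h1 : (0 : ℝ) ≤ h + (p * aSum u + q * bSum u) := by exact_mod_cast h1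
    have h2 : (h + (p * aSum u + q * bSum u) : ℝ) ≤ |(p : ℝ)| + |(q : ℝ)| := by exact_mod_cast h2
    simp only
    constructor <;> linarith

theorem exists_shortest_mem_H (hRc : R ∈ commutator F) {p q h : ℤ} (hpq : IsCoprime p q)
    (hs : Strip (slopes p q) (|p| + |q|) h R.toWord) :
    ∃ α : MulAut F, α R ∈ H ∧ ∀ β : MulAut F, FreeGroup.norm (α R) ≤ FreeGroup.norm (β R) := by
  obtain ⟨α, hα, hmin⟩ := exists_orbitMin R
  have hn : Narrow (slopes p q) R := ⟨R, IsConj.refl R, h, by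
    rw [ht_slopes_a, ht_slopes_b]
    exact hs⟩
  rw [← comp_comp_cancel (φ := slopes p q) (inv_mul_cancel α)] at hn
  have hn := hn.apply α (ht_eq_zero_of_mem_commutator _ (apply_mem_commutator hRc α))
  have hco : IsCoprime (ht (slopes p q) a) (ht (slopes p q) b) := by simpa using hpq
  obtain ⟨β, hβ, hβH⟩ := movable_of_isCoprime (isCoprime_comp hco α⁻¹) _ hα
    (apply_mem_commutator hRc α) hn
  exact ⟨β * α, hβH, fun γ => hβ.trans_le (hmin γ)⟩

theorem exists_strip_of_apply_mem_H (hRc : R ∈ commutator F) (hcr : IsCyclicallyReduced R)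
    {α : MulAut F} (hα : α R ∈ H) :
    ∃ p q h : ℤ, (p ≠ 0 ∨ q ≠ 0) ∧ Strip (slopes p q) (|p| + |q|) h R.toWord := by
  have hn : Narrow (slopes 0 1) (α R) := ⟨_, IsConj.refl _, 1, by
    simpa using (stripEl_of_mem_H hα).1⟩
  rw [← comp_comp_cancel (φ := slopes 0 1) (mul_inv_cancel α)] at hn
  have hn := hn.apply α⁻¹ (ht_eq_zero_of_mem_commutator _ (apply_mem_commutator
    (apply_mem_commutator hRc α) α⁻¹))
  rw [MulAut.inv_apply_self] at hn
  set φ := (slopes 0 1).comp α.toMonoidHom with hφ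
  have e : φ = slopes (ht φ a) (ht φ b) := hom_ext (by
    apply Multiplicative.toAdd.injective
    exact (ht_slopes_a _ _).symm) (by
    apply Multiplicative.toAdd.injective
    exact (ht_slopes_b _ _).symm)
  have hco : IsCoprime (ht (slopes 0 1) a) (ht (slopes 0 1) b) := by simp [isCoprime_one_right]
  have hco := isCoprime_comp hco α
  rw [← hφ] at hco
  obtain ⟨h, hs⟩ := hn.strip hcr (ht_eq_zero_of_mem_commutator _ hRc)
  refine ⟨ht φ a, ht φ b, h, hco.ne_zero_or_ne_zero, ?_⟩
  rwa [← e]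

end FreeGroupRankTwo

open FreeGroupRankTwo in
/-- For a nontrivial cyclically reduced `R` in the commutator subgroup of `F(a,b)`:
the Friedl–Tillmann polytope of `⟨a,b | R⟩` is a straight line but not a single point
(the convex hull of the trace of `R` is the Minkowski sum of a nondegenerate segment
and the unit square) if and only if some shortest element of the `Aut F(a,b)`-orbit
of `R` lies in `⟨a, b⁻¹ab⟩` and is not conjugate to any power of `[a,b]`. -/
theorem polytope_line_not_point_iff (R : F) (hR1 : R ≠ 1)
    (hRc : R ∈ commutator F) (hcr : IsCyclicallyReduced R) :
    (∃ x y : ℝ × ℝ, x ≠ y ∧ convexHull ℝ (trace R) = segment ℝ x y + unitSquare) ↔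
    (∃ T : F, (∃ α : F ≃* F, α R = T) ∧
      (∀ α : F ≃* F, FreeGroup.norm T ≤ FreeGroup.norm (α R)) ∧ T ∈ H ∧
      ¬ ∃ k : ℤ, IsConj T (commAB ^ k)) := by
  constructor
  · rintro ⟨x, y, hxy, h⟩
    obtain ⟨p, q, hpq, k, hk⟩ := exists_strip_of_convexHull_eq (integral_trace R) h
    have hs : Strip (slopes p q) (|p| + |q|) k R.toWord := strip_iff.2 fun u hu => by
      rw [ht_slopes_mk]
      exact hk _ _ (mem_trace hu)
    obtain ⟨α, hα, hmin⟩ := exists_shortest_mem_H hRc hpq hs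
    refine ⟨_, ⟨α, rfl⟩, hmin, hα, fun hconj => hxy ?_⟩
    obtain ⟨l, hl⟩ := exists_isConj_zpow_apply α⁻¹ hconj
    rw [MulAut.inv_apply_self] at hl
    obtain ⟨i, j, hij⟩ := subset_square_of_isConj_zpow hRc hcr hl
    exact eq_of_subset_square h hij
  · rintro ⟨_, ⟨α, rfl⟩, -, hα, hconj⟩
    obtain ⟨p, q, h, hpq, hs⟩ := exists_strip_of_apply_mem_H hRc hcr (α := α) hα
    obtain ⟨x, y, hxy⟩ := ((framed_trace hR1 hRc hcr hs).isBand
      (by exact_mod_cast hpq)).exists_convexHull_eq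
    refine ⟨x, y, ?_, hxy⟩
    rintro rfl
    refine hconj (exists_isConj_zpow_apply α (exists_isConj_zpow_of_subset_square hRc
      (i := x.1) (j := x.2) fun s hs => ?_))
    have := subset_convexHull ℝ _ hs
    rw [hxy, mem_segment_add_unitSquare] at this
    obtain ⟨μ, -, h1, h2⟩ := this
    simp only [sub_self, mul_zero, add_zero] at h1 h2
    exact ⟨h1, h2⟩
end

section
/- Let t be a set of elements of the free group F(a,y) on two generators a and y, let H be the group presented by ⟨a, y | t⟩ (the quotient of F(a,y) by the normal closure of t), and let ā and ȳ denote the images of a and y in H. Let σ : F(a,y) → F(a,b) be the homomorphism between free groups of rank two with σ(a) = a and σ(y) = b⁻¹ab, and let G be the group presented by ⟨a, b | σ(t)⟩ (the quotient of F(a,b) by the normal closure of the image σ(t)). Then for every group isomorphism φ from the cyclic subgroup of H generated by ā to the cyclic subgroup of H generated by ȳ satisfying φ(ā) = ȳ, the group G is isomorphic to the HNN extension of H with associated subgroups ⟨ā⟩ and ⟨ȳ⟩ and associated isomorphism φ (i.e., the quotient of the free product of H with an infinite cyclic group generated by a stable letter s, by the relations s⁻¹ c s = φ(c) for all c ∈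 ⟨ā⟩). -/
/-- The free group on two generators (used for both `F(a,y)` and `F(a,b)`). -/
abbrev F2 : Type := FreeGroup (Fin 2)

/-- The homomorphism `σ : F(a,y) → F(a,b)` with `σ(a) = a` and `σ(y) = b⁻¹ab`
(generator `0` plays the role of `a`; generator `1` plays the role of `y`,
respectively `b`). -/
def σ : F2 →* F2 :=
  FreeGroup.lift fun i : Fin 2 =>
    if i = 0 then FreeGroup.of 0
    else (FreeGroup.of 1)⁻¹ * FreeGroup.of 0 * FreeGroup.of 1

@[simp]
theorem σ_of_zero : σ (FreeGroup.of 0) = FreeGroup.of 0 := by simp [σ]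

@[simp]
theorem σ_of_one :
    σ (FreeGroup.of 1) = (FreeGroup.of 1)⁻¹ * FreeGroup.of 0 * FreeGroup.of 1 := by simp [σ]

/-- Compatibility of two homomorphisms with an isomorphism of cyclic subgroups, up to conjugation
by `x`, can be checked on a generator. -/
theorem mul_map_eq_map_mul_of_zpowers {H K : Type*} [Group H] [Group K] {g h : H}
    (φ : Subgroup.zpowers g ≃* Subgroup.zpowers h)
    (hφ : (φ ⟨g, Subgroup.mem_zpowers g⟩ : H) = h) (f : H →* K) (x : K)
    (hx : x * f g = f h * x) (c : Subgroup.zpowers g) :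
    x * f c = f (φ c) * x := by
  obtain ⟨_, n, rfl⟩ := c
  have hpow : (φ ⟨g ^ n, n, rfl⟩ : H) = h ^ n := by
    rw [show (⟨g ^ n, n, rfl⟩ : Subgroup.zpowers g) = ⟨g, Subgroup.mem_zpowers g⟩ ^ n from rfl,
      map_zpow, Subgroup.coe_zpow, hφ]
  change x * f (g ^ n) = f (φ ⟨g ^ n, n, rfl⟩) * x
  rw [hpow, map_zpow, map_zpow]
  exact SemiconjBy.zpow_right hx n

theorem mk_of {α : Type*} (rels : Set (FreeGroup α)) (x : α) :
    PresentedGroup.mk rels (FreeGroup.of x) = PresentedGroup.of x := rfl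

/-- The homomorphism `⟨a, y | t⟩ → ⟨a, b | σ(t)⟩` induced by `σ`. -/
def presentedMap (t : Set F2) : PresentedGroup t →* PresentedGroup (σ '' t) :=
  PresentedGroup.map σ (Set.mapsTo_image σ t)

@[simp]
theorem presentedMap_mk (t : Set F2) (w : F2) :
    presentedMap t (PresentedGroup.mk t w) = PresentedGroup.mk (σ '' t) (σ w) := rfl

@[simp]
theorem presentedMap_of_zero (t : Set F2) :
    presentedMap t (PresentedGroup.of 0) = PresentedGroup.of 0 := by
  simp [PresentedGroup.of]

@[simp]
theorem presentedMap_of_one (t : Set F2) :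
    presentedMap t (PresentedGroup.of 1) =
      (PresentedGroup.of 1)⁻¹ * PresentedGroup.of 0 * PresentedGroup.of 1 := by
  simp [PresentedGroup.of]

/-- Let `H = ⟨a, y | t⟩` with images `ā, ȳ` of the generators.  For any isomorphism
`φ : ⟨ā⟩ ≃ ⟨ȳ⟩ ` with `φ(ā) = ȳ`, the group `G = ⟨a, b | σ(t)⟩` is isomorphic to the
HNN extension of `H` over `φ`. -/
theorem presented_iso_hnn (t : Set F2)
    (φ : Subgroup.zpowers (PresentedGroup.of (rels := t) 0) ≃*
         Subgroup.zpowers (PresentedGroup.of (rels := t) 1))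
    (hφ : (φ ⟨PresentedGroup.of 0, Subgroup.mem_zpowers _⟩ : PresentedGroup t) =
      PresentedGroup.of 1) :
    Nonempty (PresentedGroup (σ '' t) ≃*
      HNNExtension (PresentedGroup t)
        (Subgroup.zpowers (PresentedGroup.of 0))
        (Subgroup.zpowers (PresentedGroup.of 1)) φ) := by
  -- Mathlib's stable letter satisfies `t * c * t⁻¹ = φ c`, so `b` corresponds to its inverse.
  let f : Fin 2 → HNNExtension (PresentedGroup t) _ _ φ :=
    ![HNNExtension.of (PresentedGroup.of 0), HNNExtension.t⁻¹]
  have hconj := HNNExtension.equiv_eq_conj (φ := φ) ⟨PresentedGroup.of 0, Subgroup.mem_zpowers _⟩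
  rw [hφ] at hconj
  have hfσ : (FreeGroup.lift f).comp σ = HNNExtension.of.comp (PresentedGroup.mk t) := by
    ext i
    fin_cases i
    · simp [f, mk_of]
    · simpa [f, mk_of] using hconj.symm
  have hrels : ∀ r ∈ σ '' t, FreeGroup.lift f r = 1 := by
    rintro _ ⟨r, hr, rfl⟩
    simpa [PresentedGroup.one_of_mem hr] using DFunLike.congr_fun hfσ r
  have hcompat := mul_map_eq_map_mul_of_zpowers φ hφ (presentedMap t) (PresentedGroup.of 1)⁻¹
    (by simp)
  refine ⟨MonoidHom.toMulEquiv (PresentedGroup.toGroup hrels)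
    (HNNExtension.lift (presentedMap t) (PresentedGroup.of 1)⁻¹ hcompat) ?_ ?_⟩
  · ext i
    fin_cases i <;> simp [f]
  · ext i
    · fin_cases i
      · simp [f]
      · simpa [f] using hconj.symm
    · simp [f]
end

section
/- Let ι : F(x,y) → F(a,b) be the homomorphism between free groups of rank two determined by ι(x) = a and ι(y) = b⁻¹ab. Then ι is injective, and for every u ∈ F(x,y) that is not a power of x (i.e., u ≠ x^k for all integers k), the reduced word lengths satisfy |u| < |ι(u)|. -/
/-- The homomorphism `ι : F(x,y) → F(a,b)` with `ι(x) = a` and `ι(y) = b⁻¹ab`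
(generator `0` plays the role of `x`, respectively `a`; generator `1` plays the
role of `y`, respectively `b`). -/
def ι : F2 →* F2 :=
  FreeGroup.lift fun i : Fin 2 =>
    if i = 0 then FreeGroup.of 0
    else (FreeGroup.of 1)⁻¹ * FreeGroup.of 0 * FreeGroup.of 1

/-- The word obtained from `w` by substituting `b⁻¹ a^±1 b` for `y^±1`, with the cancelling
pairs `b b⁻¹` removed; the flag records whether a trailing `b` is still to be written. -/
def iotaWord : Bool → List (Fin 2 × Bool) → List (Fin 2 × Bool)
  | false, [] => []
  | true, [] => [(1, true)]
  | false, (0, e) :: w => (0, e) :: iotaWord false w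
  | true, (0, e) :: w => (1, true) :: (0, e) :: iotaWord false w
  | false, (1, e) :: w => (1, false) :: (0, e) :: iotaWord true w
  | true, (1, e) :: w => (0, e) :: iotaWord true w

theorem mk_cons_eq_mul {α : Type*} (p : α × Bool) (L : List (α × Bool)) :
    FreeGroup.mk (p :: L) = FreeGroup.mk [p] * FreeGroup.mk L := by
  rw [FreeGroup.mul_mk]
  rfl

theorem iota_mk_zero (e : Bool) : ι (FreeGroup.mk [(0, e)]) = FreeGroup.mk [(0, e)] := by
  cases e <;> simp [ι, FreeGroup.of, FreeGroup.inv_mk, FreeGroup.invRev]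

theorem iota_mk_one (e : Bool) : ι (FreeGroup.mk [(1, e)]) =
    FreeGroup.mk [(1, false)] * FreeGroup.mk [(0, e)] * FreeGroup.mk [(1, true)] := by
  cases e <;> simp [ι, FreeGroup.of, FreeGroup.inv_mk, FreeGroup.invRev]

theorem mk_one_true_mul_mk_one_false :
    (FreeGroup.mk [(1, true)] * FreeGroup.mk [(1, false)] : F2) = 1 := by
  have h : (FreeGroup.mk [(1, false)] : F2) = (FreeGroup.mk [(1, true)])⁻¹ := by
    simp [FreeGroup.inv_mk, FreeGroup.invRev]
  rw [h, mul_inv_cancel]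

theorem mk_iotaWord (s : Bool) (w : List (Fin 2 × Bool)) :
    FreeGroup.mk (iotaWord s w) =
      (if s then FreeGroup.mk [(1, true)] else 1) * ι (FreeGroup.mk w) := by
  induction w generalizing s with
  | nil =>
    cases s <;> simp [iotaWord, ← FreeGroup.one_eq_mk]
  | cons p w ih =>
    obtain ⟨i, e⟩ := p
    rw [mk_cons_eq_mul (i, e) w, map_mul]
    fin_cases i <;> cases s <;>
      simp only [iotaWord, Fin.zero_eta, Fin.mk_one, iota_mk_zero, iota_mk_one]
    · rw [mk_cons_eq_mul, ih]; simp
    · rw [mk_cons_eq_mul, mk_cons_eq_mul (0, e), ih]; simp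
    · rw [mk_cons_eq_mul, mk_cons_eq_mul (0, e), ih]; simp only [if_pos, Bool.false_eq_true, if_false, one_mul, mul_assoc]
    · rw [mk_cons_eq_mul, ih, if_pos rfl, if_pos trivial, ← mul_assoc, ← mul_assoc, ← mul_assoc, ← mul_assoc,
        mk_one_true_mul_mk_one_false, one_mul]

theorem isReduced_cons_iotaWord (i : Fin 2) (e : Bool) (w : List (Fin 2 × Bool))
    (h : FreeGroup.IsReduced ((i, e) :: w)) :
    FreeGroup.IsReduced ((0, e) :: iotaWord (i == 1) w) := by
  induction w generalizing i e with
  | nil => fin_cases i <;> simp [iotaWord]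
  | cons p w ih =>
    obtain ⟨j, f⟩ := p
    rw [FreeGroup.isReduced_cons_cons] at h
    have h' := ih j f h.2
    have hef := h.1
    fin_cases i <;> fin_cases j <;> simp_all [iotaWord]

theorem isReduced_iotaWord_false (w : List (Fin 2 × Bool)) (h : FreeGroup.IsReduced w) :
    FreeGroup.IsReduced (iotaWord false w) := by
  cases w with
  | nil => simp [iotaWord]
  | cons p w =>
    obtain ⟨j, f⟩ := p
    have h' := isReduced_cons_iotaWord j f w h
    fin_cases j <;> simp_all [iotaWord]

theorem length_le_length_iotaWord (s : Bool) (w : List (Fin 2 × Bool)) :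
    w.length + s.toNat ≤ (iotaWord s w).length := by
  induction w generalizing s with
  | nil => cases s <;> simp [iotaWord]
  | cons p w ih =>
    obtain ⟨j, f⟩ := p
    have h₀ := ih false
    have h₁ := ih true
    fin_cases j <;> cases s <;> simp [iotaWord] at * <;> omega

theorem mk_mem_zpowers_or_length_lt (w : List (Fin 2 × Bool)) :
    FreeGroup.mk w ∈ Subgroup.zpowers (FreeGroup.of (0 : Fin 2)) ∨
      w.length < (iotaWord false w).length := by
  induction w with
  | nil => exact Or.inl (one_mem _)
  | cons p w ih =>
    obtain ⟨j, f⟩ := p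
    have h₁ := length_le_length_iotaWord true w
    fin_cases j
    · refine ih.imp (fun h => ?_) (fun h => by simpa [iotaWord] using h)
      rw [mk_cons_eq_mul]
      refine mul_mem ?_ h
      cases f
      · exact inv_mem (Subgroup.mem_zpowers (FreeGroup.of (0 : Fin 2)))
      · exact Subgroup.mem_zpowers _
    · right
      simp [iotaWord] at *
      omega

theorem norm_iota (u : F2) : FreeGroup.norm (ι u) = (iotaWord false u.toWord).length := by
  have h := mk_iotaWord false u.toWord
  rw [FreeGroup.mk_toWord, if_neg Bool.false_ne_true, one_mul] at h
  rw [← h, FreeGroup.norm, FreeGroup.toWord_mk,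
    (isReduced_iotaWord_false _ FreeGroup.isReduced_toWord).reduce_eq]

theorem norm_lt_norm_iota (u : F2) (hu : ∀ k : ℤ, u ≠ (FreeGroup.of 0) ^ k) :
    FreeGroup.norm u < FreeGroup.norm (ι u) := by
  rw [norm_iota]
  refine (mk_mem_zpowers_or_length_lt u.toWord).resolve_left fun h => ?_
  rw [FreeGroup.mk_toWord] at h
  obtain ⟨k, hk⟩ := Subgroup.mem_zpowers_iff.mp h
  exact hu k hk.symm

/-- The homomorphism `ι : F(x,y) → F(a,b)`, `x ↦ a`, `y ↦ b⁻¹ab`, is injective, and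
strictly increases the reduced word length of every element that is not a power
of `x`. -/
theorem iota_injective_and_length_lt :
    Function.Injective ι ∧
    ∀ u : F2, (∀ k : ℤ, u ≠ (FreeGroup.of 0) ^ k) →
      FreeGroup.norm u < FreeGroup.norm (ι u) := by
  refine ⟨(injective_iff_map_eq_one ι).mpr fun u hu => ?_, norm_lt_norm_iota⟩
  by_cases h : ∀ k : ℤ, u ≠ (FreeGroup.of 0) ^ k
  · have := norm_lt_norm_iota u h
    simp [hu] at this
  · push Not at h
    obtain ⟨k, rfl⟩ := h
    rw [map_zpow] at hu
    rwa [show ι (FreeGroup.of 0) = FreeGroup.of 0 from iota_mk_zero true] at hu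
end
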